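/- arXiv:2601.15204 — 2 statements merged into one kernel-verified Lean document; each statement's English description precedes it below -/
import Mathlib

section
/- Let p ∈ [1, ∞) with p ≠ 2, let m, n ≥ 1, and let k_1, …, k_m and ℓ_1, …, ℓ_n be integers ≥ 2. Let A ⊆ B(ℓ^p(ℕ^m)) be the smallest closed subalgebra containing the operators S_{i,j}, T_{i,j} for 1 ≤ i ≤ m, 0 ≤ j < k_i (defined below, relative to the alphabet sizes k_1,…,k_m), and let B ⊆ B(ℓ^p(ℕ^n)) be the smallest closed subalgebra containing the analogous operators relative to ℓ_1, …, ℓ_n. If there exists a unital contractive algebra homomorphism A → B (where the units are the respective identity operators), then m ≤ n. -/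
namespace CTR
open Finset Equiv

def vtx {d : ℕ} (v : Fin d → ℕ) (π : Perm (Fin d)) (k : ℕ) : Fin d → ℕ :=
  fun j => v j + if (π.symm j : ℕ) < k then 1 else 0

def mat {d : ℕ} (u : Fin d → (Fin d → ℕ) → ℤ) (v : Fin d → ℕ) (π : Perm (Fin d)) :
    Matrix (Fin (d+1)) (Fin (d+1)) ℤ :=
  Matrix.of fun r k => Fin.cases (motive := fun _ => ℤ) 1 (fun i => u i (vtx v π k)) r

@[simp] lemma mat_zero {d : ℕ} (u : Fin d → (Fin d → ℕ) → ℤ) (v : Fin d → ℕ) (π : Perm (Fin d)) (k) :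
    mat u v π 0 k = 1 := rfl
@[simp] lemma mat_succ {d : ℕ} (u : Fin d → (Fin d → ℕ) → ℤ) (v : Fin d → ℕ) (π : Perm (Fin d)) (i k) :
    mat u v π (Fin.succ i) k = u i (vtx v π k) := rfl

lemma det_zero_of_row {ι : Type*} [Fintype ι] [DecidableEq ι] (M : Matrix ι ι ℤ) (r r0 : ι) (h : r ≠ r0) (c : ℤ)
    (hr : ∀ k, M r k = c * M r0 k) : M.det = 0 := by
  rw [← Matrix.det_updateRow_add_smul_self M h (-c)]
  apply Matrix.det_eq_zero_of_row_eq_zero r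
  intro k
  simp [hr]

lemma adj_col {ι : Type*} [Fintype ι] [DecidableEq ι] (M : Matrix ι ι ℤ) (k r : ι) :
    M.adjugate k r = (M.updateCol k (Pi.single r 1)).det := by
  have := Matrix.adjugate_apply M.transpose r k
  rw [← Matrix.adjugate_transpose, Matrix.transpose_apply] at this
  rw [this, ← Matrix.det_transpose, Matrix.updateRow_transpose, Matrix.transpose_transpose]

/-- facet term -/
def fac {d : ℕ} (u : Fin d → (Fin d → ℕ) → ℤ) (i : Fin d) (v : Fin d → ℕ) (π : Perm (Fin d))
    (k : Fin (d+1)) : ℤ :=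
  ((mat u v π).updateCol k (Pi.single i.succ 1)).det *
    ∑ j ∈ univ.erase k, u i (vtx v π (j : Fin (d+1)))

lemma det_eq_fac {d : ℕ} (u : Fin d → (Fin d → ℕ) → ℤ) (i : Fin d) (v : Fin d → ℕ) (π : Perm (Fin d)) :
    (mat u v π).det = - ∑ k, fac u i v π k := by
  have h0 : ∑ k, (mat u v π).adjugate k i.succ = 0 := by
    have := congrFun (congrFun (Matrix.mul_adjugate (mat u v π)) 0) i.succ
    rw [Matrix.mul_apply] at this
    simpa [Matrix.one_apply, (Fin.succ_ne_zero i).symm] using this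
  rw [Matrix.det_eq_sum_mul_adjugate_row _ i.succ]
  simp only [fac, ← adj_col, mat_succ]
  have h1 : ∀ k : Fin (d+1), ∑ j ∈ univ.erase k, u i (vtx v π (j : Fin (d+1)))
      = (∑ j : Fin (d+1), u i (vtx v π j)) - u i (vtx v π k) := by
    intro k
    rw [← Finset.add_sum_erase univ (fun j : Fin (d+1) => u i (vtx v π j)) (mem_univ k)]; ring
  simp only [h1, mul_sub, Finset.sum_sub_distrib, ← Finset.sum_mul, h0]
  simp [mul_comm]

lemma fac_congr {d : ℕ} (u : Fin d → (Fin d → ℕ) → ℤ) (i : Fin d) (v : Fin d → ℕ) (π π' : Perm (Fin d))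
    (k : Fin (d+1)) (h : ∀ j : Fin (d+1), j ≠ k → vtx v π j = vtx v π' j) :
    fac u i v π k = fac u i v π' k := by
  unfold fac
  congr 1
  · congr 1
    ext r c
    by_cases hc : c = k
    · subst hc; simp
    · rw [Matrix.updateCol_ne hc, Matrix.updateCol_ne hc]
      refine Fin.cases ?_ (fun j => ?_) r
      · simp
      · simp [h c hc]
  · apply Finset.sum_congr rfl
    intro j hj
    rw [h j (by simpa using hj)]

lemma fac_zero_of_face {d : ℕ} (u : Fin d → (Fin d → ℕ) → ℤ) (i : Fin d) (R : ℕ) (c : ℤ)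
    (hd0 : ∀ x, x i = 0 → u i x = 0) (hdR : ∀ x, x i = R → u i x = 0)
    (hc0 : ∀ j, j ≠ i → ∀ x, x j = 0 → u j x = 0)
    (hcR : ∀ j, j ≠ i → ∀ x, x j = R → u j x = c)
    (v : Fin d → ℕ) (π : Perm (Fin d)) (k : Fin (d+1)) (e : Fin d)
    (h : (∀ j : Fin (d+1), j ≠ k → vtx v π j e = 0) ∨ (∀ j : Fin (d+1), j ≠ k → vtx v π j e = R)) :
    fac u i v π k = 0 := by
  unfold fac
  by_cases he : e = i
  · subst he
    rw [Finset.sum_eq_zero, mul_zero]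
    intro j hj
    rcases h with h | h
    · exact hd0 _ (h j (by simpa using hj))
    · exact hdR _ (h j (by simpa using hj))
  · have : ∃ c' : ℤ, ∀ j : Fin (d+1), j ≠ k → u e (vtx v π j) = c' := by
      rcases h with h | h
      · exact ⟨0, fun j hj => hc0 e he _ (h j hj)⟩
      · exact ⟨c, fun j hj => hcR e he _ (h j hj)⟩
    obtain ⟨c', hc'⟩ := this
    rw [det_zero_of_row _ e.succ 0 (Fin.succ_ne_zero e) c', zero_mul]
    intro j
    by_cases hj : j = k
    · subst hj
      simp [he, (Fin.succ_ne_zero i).symm]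
    · simp [Matrix.updateCol_ne hj, hc' j hj]

lemma sum_shift {d : ℕ} (R : ℕ) (e : Fin d) (H : (Fin d → ℕ) → ℤ)
    (h0 : ∀ v, v e = 0 → H v = 0) (hR : ∀ v, v e = R → H v = 0) :
    ∑ v ∈ Fintype.piFinset (fun _ : Fin d => range R), H (Function.update v e (v e + 1)) =
    ∑ v ∈ Fintype.piFinset (fun _ : Fin d => range R), H v := by
  refine Finset.sum_bij_ne_zero (fun v _ _ => Function.update v e (v e + 1)) ?_ ?_ ?_ ?_
  · intro v hv hne
    rw [Fintype.mem_piFinset] at hv ⊢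
    intro j
    by_cases hj : j = e
    · subst hj
      have := hv j
      simp only [Function.update_self, mem_range] at *
      by_contra hcon
      exact hne (hR _ (by simp; omega))
    · simpa [hj] using hv j
  · intro v hv _ w hw _ heq
    ext j
    have := congrFun heq j
    by_cases hj : j = e
    · subst hj; simpa using this
    · simpa [hj] using this
  · intro v hv hne
    have hve : v e ≠ 0 := fun h => hne (h0 v h)
    have h1 : Function.update (Function.update v e (v e - 1)) e ((Function.update v e (v e - 1)) e + 1) = v := by
      ext j
      by_cases hj : j = e
      · subst hj; simp; omega
      · simp [hj]
    refine ⟨Function.update v e (v e - 1), ?_, ?_, h1⟩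
    · rw [Fintype.mem_piFinset] at hv ⊢
      intro j
      by_cases hj : j = e
      · subst hj
        have := hv j
        simp only [Function.update_self, mem_range] at *
        omega
      · simpa [hj] using hv j
    · rw [h1]; exact hne
  · intros; rfl

def Phi {d : ℕ} (R : ℕ) (u : Fin d → (Fin d → ℕ) → ℤ) : ℤ :=
  ∑ v ∈ Fintype.piFinset (fun _ : Fin d => range R), ∑ π : Perm (Fin d),
    (Perm.sign π : ℤ) * (mat u v π).det

lemma mid_zero {N : ℕ} (u : Fin (N+1) → (Fin (N+1) → ℕ) → ℤ) (i : Fin (N+1)) (v : Fin (N+1) → ℕ)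
    (j : Fin N) :
    ∑ π : Perm (Fin (N+1)), (Perm.sign π : ℤ) * fac u i v π j.castSucc.succ = 0 := by
  have hne : j.castSucc ≠ j.succ := by simp [Fin.ext_iff]
  have key : ∀ π : Perm (Fin (N+1)), fac u i v (π * swap j.castSucc j.succ) j.castSucc.succ
      = fac u i v π j.castSucc.succ := by
    intro π
    apply fac_congr
    intro t ht
    ext x
    unfold vtx
    congr 1
    have h1 : (π * swap j.castSucc j.succ).symm x = swap j.castSucc j.succ (π.symm x) := by
      rw [Equiv.symm_apply_eq]; simp
    rw [h1]
    have ht' : (t : ℕ) ≠ j + 1 := fun h => ht (by ext; simpa using h)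
    generalize π.symm x = y
    rw [Equiv.swap_apply_def]
    by_cases h1 : y = j.castSucc
    · subst h1
      simp only [if_true, Fin.val_succ, Fin.val_castSucc]
      congr 1
      apply propext
      omega
    · by_cases h2 : y = j.succ
      · subst h2
        simp only [hne.symm, if_false, if_true, Fin.val_succ, Fin.val_castSucc]
        congr 1
        apply propext
        omega
      · simp [h1, h2]
  have := Equiv.sum_comp (Equiv.mulRight (swap j.castSucc j.succ))
    (fun π : Perm (Fin (N+1)) => (Perm.sign π : ℤ) * fac u i v π j.castSucc.succ)
  simp only [Equiv.coe_mulRight, key, Perm.sign_mul, Perm.sign_swap hne] at this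
  simp only [mul_neg, mul_one, Units.val_neg, neg_mul, Finset.sum_neg_distrib] at this
  omega

lemma vtx_rot {N : ℕ} (v : Fin (N+1) → ℕ) (π : Perm (Fin (N+1))) (k : ℕ) (hk : k ≤ N) :
    vtx (Function.update v (π 0) (v (π 0) + 1)) (π * finRotate (N+1)) k = vtx v π (k+1) := by
  ext j
  unfold vtx
  have h1 : (π * finRotate (N+1)).symm j = (finRotate (N+1)).symm (π.symm j) := by
    rw [Equiv.symm_apply_eq]; simp
  rw [h1]
  obtain ⟨y, rfl⟩ := π.surjective j
  simp only [Equiv.symm_apply_apply]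
  by_cases hy : y = 0
  · subst hy
    have : (finRotate (N+1)).symm 0 = Fin.last N := by
      rw [Equiv.symm_apply_eq]; simp
    simp [this]; omega
  · have h2 : (((finRotate (N+1)).symm y : Fin (N+1)) : ℕ) = y - 1 := by
      obtain ⟨z, rfl⟩ := (finRotate (N+1)).surjective y
      rw [Equiv.symm_apply_apply]
      have hz : z ≠ Fin.last N := by
        rintro rfl; exact hy finRotate_last
      rw [coe_finRotate_of_ne_last hz]; simp
    have h3 : π y ≠ π 0 := by simpa using hy
    have h4 : (y : ℕ) ≠ 0 := by exact (fun h => hy (Fin.ext h))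
    rw [h2, Function.update_of_ne h3]
    congr 2
    apply propext; omega

lemma fac_rot {N : ℕ} (u : Fin (N+1) → (Fin (N+1) → ℕ) → ℤ) (i : Fin (N+1)) (v : Fin (N+1) → ℕ)
    (π : Perm (Fin (N+1))) :
    fac u i (Function.update v (π 0) (v (π 0) + 1)) (π * finRotate (N+1)) (Fin.last (N+1)) =
     (-1)^(N+1) * fac u i v π 0 := by
  unfold fac
  rw [← mul_assoc]
  congr 1
  · have := Matrix.det_permute' (finRotate (N+2)) ((mat u v π).updateCol 0 (Pi.single i.succ 1))
    rw [sign_finRotate] at this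
    push_cast at this
    rw [← this]
    congr 1
    ext r c
    rw [Matrix.submatrix_apply]
    refine Fin.lastCases ?_ (fun c => ?_) c
    · simp
    · have hc : (finRotate (N+2)) c.castSucc = c.succ := by
        rw [finRotate_apply]; simp
      rw [hc, Matrix.updateCol_ne (Fin.castSucc_lt_last c).ne, id, Matrix.updateCol_ne (Fin.succ_ne_zero c)]
      refine Fin.cases ?_ (fun j => ?_) r
      · simp
      · simp only [mat_succ, Fin.val_castSucc, Fin.val_succ]
        rw [vtx_rot _ _ _ (by omega)]
  · have h1 : ∀ (g : Fin (N+2) → ℤ), ∑ j ∈ univ.erase (Fin.last (N+1)), g j = ∑ j : Fin (N+1), g j.castSucc := by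
      intro g
      have := Finset.add_sum_erase univ g (mem_univ (Fin.last (N+1)))
      rw [Fin.sum_univ_castSucc] at this
      linarith
    have h2 : ∀ (g : Fin (N+2) → ℤ), ∑ j ∈ univ.erase 0, g j = ∑ j : Fin (N+1), g j.succ := by
      intro g
      have := Finset.add_sum_erase univ g (mem_univ 0)
      rw [Fin.sum_univ_succ] at this
      linarith
    rw [h1, h2]
    apply Finset.sum_congr rfl
    intro j _
    simp only [Fin.val_castSucc, Fin.val_succ]
    rw [vtx_rot _ _ _ (by omega)]

lemma Phi_zero {N : ℕ} (R : ℕ) (u : Fin (N+1) → (Fin (N+1) → ℕ) → ℤ) (i : Fin (N+1)) (c : ℤ)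
    (hd0 : ∀ x, x i = 0 → u i x = 0) (hdR : ∀ x, x i = R → u i x = 0)
    (hc0 : ∀ j, j ≠ i → ∀ x, x j = 0 → u j x = 0)
    (hcR : ∀ j, j ≠ i → ∀ x, x j = R → u j x = c) : Phi R u = 0 := by
  unfold Phi
  set box := Fintype.piFinset (fun _ : Fin (N+1) => range R)
  have hface := fac_zero_of_face u i R c hd0 hdR hc0 hcR
  have e1 : ∀ v, ∑ π : Perm (Fin (N+1)), (Perm.sign π : ℤ) * (mat u v π).det =
      - (∑ π : Perm (Fin (N+1)), (Perm.sign π : ℤ) * fac u i v π 0 +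
        ∑ π : Perm (Fin (N+1)), (Perm.sign (π * finRotate (N+1)) : ℤ) *
          fac u i v (π * finRotate (N+1)) (Fin.last (N+1))) := by
    intro v
    have := Equiv.sum_comp (Equiv.mulRight (finRotate (N+1)))
      (fun π : Perm (Fin (N+1)) => (Perm.sign π : ℤ) * fac u i v π (Fin.last (N+1)))
    simp only [Equiv.coe_mulRight] at this
    rw [this]
    have h3 : ∀ π : Perm (Fin (N+1)), (Perm.sign π : ℤ) * (mat u v π).det =
      - ((Perm.sign π : ℤ) * fac u i v π 0 + (Perm.sign π : ℤ) * fac u i v π (Fin.last (N+1)) +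
         ∑ j : Fin N, (Perm.sign π : ℤ) * fac u i v π j.castSucc.succ) := by
      intro π
      rw [det_eq_fac u i, Fin.sum_univ_succ, Fin.sum_univ_castSucc, ← Finset.mul_sum, Fin.succ_last]
      ring
    simp only [h3, Finset.sum_neg_distrib, Finset.sum_add_distrib]
    rw [Finset.sum_comm (s := univ) (t := univ) (f := fun (π : Perm (Fin (N+1))) (j : Fin N) => _)]
    simp [mid_zero]
  simp only [e1]
  rw [Finset.sum_neg_distrib, Finset.sum_add_distrib, Finset.sum_comm, Finset.sum_comm (s := box), ← Finset.sum_add_distrib]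
  rw [Finset.sum_eq_zero, neg_zero]
  intro π _
  have hrot : ∀ v, (Perm.sign π : ℤ) * fac u i v π 0 = - ((Perm.sign (π * finRotate (N+1)) : ℤ) *
          fac u i (Function.update v (π 0) (v (π 0) + 1)) (π * finRotate (N+1)) (Fin.last (N+1))) := by
    intro v
    rw [fac_rot, Perm.sign_mul, sign_finRotate]
    push_cast
    have : ((-1:ℤ)^N * (-1)^N) = 1 := by rw [← mul_pow]; simp
    rw [pow_succ]
    linear_combination (- (Perm.sign π : ℤ) * fac u i v π 0) * this
  rw [Finset.sum_congr rfl (fun v _ => hrot v), Finset.sum_neg_distrib]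
  have := sum_shift R (π 0) (fun v => (Perm.sign (π * finRotate (N+1)) : ℤ) *
          fac u i v (π * finRotate (N+1)) (Fin.last (N+1))) ?_ ?_
  · rw [this]; ring
  all_goals
    intro v hv
    rw [hface v _ _ (π 0), mul_zero]
  · left
    intro j hj
    have : (π * finRotate (N+1)).symm (π 0) = Fin.last N := by
      rw [Equiv.symm_apply_eq]; simp
    have hj' : (j : ℕ) ≠ N + 1 := fun h => hj (by ext; simpa using h)
    simp [vtx, this, hv]; omega
  · right
    intro j hj
    have : (π * finRotate (N+1)).symm (π 0) = Fin.last N := by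
      rw [Equiv.symm_apply_eq]; simp
    have hj' : (j : ℕ) ≠ N + 1 := fun h => hj (by ext; simpa using h)
    simp [vtx, this, hv]; omega

lemma mat_update_det {d : ℕ} (u : Fin d → (Fin d → ℕ) → ℤ) (i : Fin d) (f g : (Fin d → ℕ) → ℤ) (v π) :
    (mat (Function.update u i (f - g)) v π).det = (mat (Function.update u i f) v π).det
      - (mat (Function.update u i g) v π).det := by
  have h : ∀ f, mat (Function.update u i f) v π = (mat u v π).updateRow i.succ (fun k => f (vtx v π k)) := by
    intro f
    ext r k
    refine Fin.cases ?_ (fun j => ?_) r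
    · rw [Matrix.updateRow_ne (Fin.succ_ne_zero i).symm]; simp
    · by_cases hj : j = i
      · subst hj; simp
      · rw [Matrix.updateRow_ne (by simpa using hj)]; simp [hj]
  rw [h, h, h]
  have : (fun k : Fin (d+1) => (f - g) (vtx v π k)) =
    (fun k : Fin (d+1) => f (vtx v π k)) + (-1 : ℤ) • (fun k : Fin (d+1) => g (vtx v π k)) := by
    ext k; simp; ring
  rw [this, Matrix.det_updateRow_add, Matrix.det_updateRow_smul]; ring

lemma Phi_sub {d : ℕ} (R : ℕ) (u : Fin d → (Fin d → ℕ) → ℤ) (i : Fin d) (f g : (Fin d → ℕ) → ℤ) :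
    Phi R (Function.update u i (f - g)) = Phi R (Function.update u i f) - Phi R (Function.update u i g) := by
  unfold Phi
  simp only [mat_update_det, mul_sub, Finset.sum_sub_distrib]

def Good {d : ℕ} (R : ℕ) (i : Fin d) (f : (Fin d → ℕ) → ℤ) : Prop :=
  (∀ x, x i = 0 → f x = 0) ∧ (∀ x, x i = R → f x = R)

lemma Phi_replace {N : ℕ} (R : ℕ) (u : Fin (N+1) → (Fin (N+1) → ℕ) → ℤ) (hu : ∀ i, Good R i (u i))
    (i : Fin (N+1)) (g : (Fin (N+1) → ℕ) → ℤ) (hg : Good R i g) :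
    Phi R (Function.update u i g) = Phi R u := by
  have h1 := Phi_sub R u i (u i) g
  rw [Function.update_eq_self] at h1
  rw [Phi_zero R (Function.update u i (u i - g)) i R] at h1
  · omega
  · intro x hx; simp [(hu i).1 x hx, hg.1 x hx]
  · intro x hx; simp [(hu i).2 x hx, hg.2 x hx]
  · intro j hj x hx; simp [hj, (hu j).1 x hx]
  · intro j hj x hx; simp [hj, (hu j).2 x hx]

lemma Phi_eq {N : ℕ} (R : ℕ) (u w : Fin (N+1) → (Fin (N+1) → ℕ) → ℤ) (hu : ∀ i, Good R i (u i))
    (hw : ∀ i, Good R i (w i)) : Phi R u = Phi R w := by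
  have : ∀ s : Finset (Fin (N+1)), Phi R (fun i => if i ∈ s then w i else u i) = Phi R u := by
    intro s
    induction s using Finset.induction_on with
    | empty => simp
    | insert a s ha ih =>
      rw [← ih, ← Phi_replace R (fun i => if i ∈ s then w i else u i) _ a (w a) (hw a)]
      · congr 1
        ext i x
        by_cases hi : i = a
        · subst hi; simp
        · simp [hi]
      · intro i
        show Good R i (if i ∈ s then w i else u i)
        split_ifs
        · exact hw i
        · exact hu i
  have h := this univ
  simpa using h.symm

lemma det_coord {d : ℕ} (v : Fin d → ℕ) (π : Perm (Fin d)) :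
    (mat (fun i x => (x i : ℤ)) v π).det = Perm.sign π := by
  have h1 : (mat (fun i x => (x i : ℤ)) v π).det =
      (Matrix.of fun (r k : Fin (d+1)) => Fin.cases (motive := fun _ => ℤ) 1
        (fun i => if (π.symm i : ℕ) < k then 1 else 0) r).det := by
    apply Matrix.det_eq_of_forall_row_eq_smul_add_const
      (fun r => Fin.cases (motive := fun _ => ℤ) 0 (fun i => (v i : ℤ)) r) 0
    · rfl
    · intro r k
      refine Fin.cases ?_ (fun j => ?_) r
      · simp
      · simp [vtx]; ring
  rw [h1, Matrix.det_succ_column_zero, Fin.sum_univ_succ]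
  simp only [Matrix.of_apply, Fin.val_zero, not_lt_zero, if_false]
  simp only [Fin.cases_zero, Fin.cases_succ, mul_zero, zero_mul, Finset.sum_const_zero, add_zero, pow_zero, one_mul]
  have h2 : (Matrix.of fun (r k : Fin d) => if r ≤ k then (1:ℤ) else 0).det = 1 := by
    rw [Matrix.det_of_isUpperTriangular]
    · simp
    · intro a b hab
      simp at hab
      simp [hab]
  have h3 := Matrix.det_permute π.symm (Matrix.of fun (r k : Fin d) => if r ≤ k then (1:ℤ) else 0)
  rw [h2, mul_one, Perm.sign_symm, Int.cast_id] at h3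
  rw [← h3]
  congr 1
  ext r k
  simp only [Matrix.submatrix_apply, Matrix.of_apply, id, Fin.succAbove_zero, Fin.cases_succ, Fin.val_succ, Fin.le_def]
  congr 1
  apply propext; omega

/-- Discrete Lebesgue covering / Hex lemma. -/
lemma hex {N R : ℕ} (hR : 0 < R) (u : Fin (N+1) → (Fin (N+1) → ℕ) → ℤ) (hu : ∀ i, Good R i (u i))
    (hc : ∀ v : Fin (N+1) → ℕ, ∃ i, ∃ c, ∀ w : Fin (N+1) → ℕ, (∀ j, v j ≤ w j ∧ w j ≤ v j + 1) → u i w = c) :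
    False := by
  have h1 : Phi R u = 0 := by
    unfold Phi
    refine Finset.sum_eq_zero fun v _ => Finset.sum_eq_zero fun π _ => ?_
    obtain ⟨i, c, h⟩ := hc v
    rw [det_zero_of_row _ i.succ 0 (Fin.succ_ne_zero i) c, mul_zero]
    intro k
    simp only [mat_succ, mat_zero, mul_one]
    apply h
    intro j
    unfold vtx
    split_ifs <;> omega
  rw [Phi_eq R u (fun i x => (x i : ℤ)) hu (fun i => ⟨fun x hx => by simp [hx], fun x hx => by simp [hx]⟩)] at h1
  unfold Phi at h1
  simp only [det_coord] at h1
  have h2 : ∀ π : Perm (Fin (N+1)), (Perm.sign π : ℤ) * (Perm.sign π : ℤ) = 1 := by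
    intro π
    rw [← Units.val_mul, Int.units_mul_self]; rfl
  simp only [h2] at h1
  simp [Fintype.card_perm, Nat.factorial_ne_zero] at h1
  omega
end CTR
namespace CTR
open Finset

def D {n : ℕ} (l : Fin n → ℕ) (r : ℕ) (b b' : Fin n → ℕ) : Prop :=
  ∀ i, ∃ s t, s ≤ r ∧ t ≤ r ∧ b i / l i ^ s = b' i / l i ^ t

lemma D.symm {n : ℕ} {l : Fin n → ℕ} {r : ℕ} {b b' : Fin n → ℕ} (h : D l r b b') : D l r b' b := by
  intro i
  obtain ⟨s, t, hs, ht, h⟩ := h i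
  exact ⟨t, s, ht, hs, h.symm⟩

lemma D.refl {n : ℕ} (l : Fin n → ℕ) (b : Fin n → ℕ) : D l 0 b b :=
  fun _ => ⟨0, 0, le_rfl, le_rfl, rfl⟩

lemma D.mono {n : ℕ} {l : Fin n → ℕ} {r r' : ℕ} {b b' : Fin n → ℕ} (h : D l r b b') (hr : r ≤ r') :
    D l r' b b' := by
  intro i
  obtain ⟨s, t, hs, ht, h⟩ := h i
  exact ⟨s, t, hs.trans hr, ht.trans hr, h⟩

lemma D.trans {n : ℕ} {l : Fin n → ℕ} {r r' : ℕ} {b b' b'' : Fin n → ℕ} (h : D l r b b')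
    (h' : D l r' b' b'') : D l (r + r') b b'' := by
  intro i
  obtain ⟨s, t, hs, ht, h⟩ := h i
  obtain ⟨s', t', hs', ht', h'⟩ := h' i
  rcases le_total t s' with hle | hle
  · refine ⟨s + (s' - t), t', by omega, by omega, ?_⟩
    rw [← h', pow_add, ← Nat.div_div_eq_div_mul, h, Nat.div_div_eq_div_mul, ← pow_add]
    congr 2; omega
  · refine ⟨s, t' + (t - s'), by omega, by omega, ?_⟩
    rw [h, pow_add, ← Nat.div_div_eq_div_mul, ← h', Nat.div_div_eq_div_mul, ← pow_add]
    congr 2; omega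

def dep (l b : ℕ) : ℕ := (Nat.digits l b).length

lemma dep_div {l : ℕ} (hl : 2 ≤ l) (b : ℕ) : dep l (b / l) = dep l b - 1 := by
  unfold dep
  rcases Nat.eq_zero_or_pos b with rfl | hb
  · simp
  · rw [Nat.digits_def' (by omega) hb]; simp

lemma dep_div_pow {l : ℕ} (hl : 2 ≤ l) (b s : ℕ) : dep l (b / l ^ s) = dep l b - s := by
  induction s with
  | zero => simp
  | succ s ih =>
    rw [pow_succ, ← Nat.div_div_eq_div_mul, dep_div hl, ih]; omega

lemma dep_zero {l b : ℕ} (h : dep l b = 0) : b = 0 := by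
  unfold dep at h
  rwa [List.length_eq_zero_iff, Nat.digits_eq_nil_iff_eq_zero] at h

/-- shifted depth -/
def xx (n P c l b : ℕ) : ℕ := dep l b + (n + 1) * P - (c + 1) * P

lemma tree_key {n P L c l : ℕ} (hl : 2 ≤ l) (hc : c ≤ n) (hLP : L < P) {b b' s s' : ℕ} (hs : s ≤ L) (hs' : s' ≤ L)
    (h : b / l ^ s = b' / l ^ s')
    (hg : xx n P c l b % ((n + 1) * P) < (n + 1) * P - P)
    (hg' : xx n P c l b' % ((n + 1) * P) < (n + 1) * P - P) :
    xx n P c l b / ((n + 1) * P) = xx n P c l b' / ((n + 1) * P) ∧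
    b / l ^ (xx n P c l b % ((n + 1) * P) + L) = b' / l ^ (xx n P c l b' % ((n + 1) * P) + L) := by
  have hd : dep l b - s = dep l b' - s' := by
    rw [← dep_div_pow hl, ← dep_div_pow hl, h]
  have hW : (c + 1) * P ≤ (n + 1) * P := Nat.mul_le_mul_right _ (by omega)
  have hx : xx n P c l b = dep l b + ((n + 1) * P - (c + 1) * P) := by unfold xx; omega
  have hx' : xx n P c l b' = dep l b' + ((n + 1) * P - (c + 1) * P) := by unfold xx; omega
  generalize (n + 1) * P - (c + 1) * P = o at hx hx'
  generalize xx n P c l b = x at *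
  generalize xx n P c l b' = x' at *
  generalize (n + 1) * P = W at *
  have e1 := Nat.div_add_mod x W
  have e2 := Nat.div_add_mod x' W
  have hq : x / W = x' / W := by
    rcases lt_trichotomy (x / W) (x' / W) with h1 | h1 | h1
    · have : W * (x / W + 1) ≤ W * (x' / W) := Nat.mul_le_mul_left _ h1
      rw [mul_add, mul_one] at this
      omega
    · exact h1
    · have : W * (x' / W + 1) ≤ W * (x / W) := Nat.mul_le_mul_left _ h1
      rw [mul_add, mul_one] at this
      omega
  refine ⟨hq, ?_⟩
  rw [hq] at e1
  have f1 : b / l ^ (x % W + L) = b / l ^ s / l ^ (x % W + L - s) := by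
    rw [Nat.div_div_eq_div_mul, ← pow_add]; congr 2; omega
  have f2 : b' / l ^ (x' % W + L) = b' / l ^ s' / l ^ (x' % W + L - s') := by
    rw [Nat.div_div_eq_div_mul, ← pow_add]; congr 2; omega
  rw [f1, f2, ← h]
  by_cases h0 : b / l ^ s = 0
  · simp [h0]
  · have : dep l b - s ≠ 0 := by
      rw [← dep_div_pow hl]; exact fun hh => h0 (dep_zero hh)
    congr 2
    omega

lemma bad_unique {n P c l b : ℕ} (hP : 0 < P) (hc : c ≤ n)
    (hg : ¬ xx n P c l b % ((n + 1) * P) < (n + 1) * P - P) :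
    ((dep l b) % ((n + 1) * P)) / P = c := by
  have hW : (c + 1) * P ≤ (n + 1) * P := Nat.mul_le_mul_right _ (by omega)
  have hx : xx n P c l b + (c + 1) * P = dep l b + (n + 1) * P := by unfold xx; omega
  have e1 := Nat.div_add_mod (xx n P c l b) ((n + 1) * P)
  have hlt := Nat.mod_lt (xx n P c l b) (show 0 < (n + 1) * P by positivity)
  generalize xx n P c l b = x at *
  have hP' : P ≤ (n + 1) * P := Nat.le_mul_of_pos_left _ (by omega)
  have : dep l b = (c * P + (x % ((n+1)*P) + P - (n + 1) * P)) + ((n + 1) * P) * (x / ((n+1)*P)) := by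
    rw [add_mul, one_mul] at hx
    omega
  rw [this, Nat.add_mul_mod_self_left, Nat.mod_eq_of_lt, add_comm, Nat.add_mul_div_right _ _ hP, Nat.div_eq_of_lt, zero_add]
  · omega
  · rw [add_mul, one_mul] at hW
    omega

theorem coloring (n : ℕ) (l : Fin n → ℕ) (hl : ∀ i, 2 ≤ l i) (L : ℕ) :
    ∃ (good : Fin (n+1) → (Fin n → ℕ) → Prop) (key : Fin (n+1) → (Fin n → ℕ) → (Fin n → ℕ × ℕ))
      (X : Type) (_ : Fintype X) (code : Fin (n+1) → (Fin n → ℕ) → X),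
      (∀ b, ∃ c, good c b) ∧
      (∀ c b b', good c b → good c b' → D l L b b' → key c b = key c b') ∧
      (∀ c b b', key c b = key c b' → code c b = code c b' → b = b') := by
  set P := L + 1 with hP
  set W := (n + 1) * P with hWdef
  have hW : 0 < W := by positivity
  refine ⟨fun c b => ∀ i, xx n P c (l i) (b i) % W < W - P,
    fun c b i => (xx n P c (l i) (b i) / W, b i / l i ^ (xx n P c (l i) (b i) % W + L)),
    ∀ i, Fin W × Fin (l i ^ (W + L)), inferInstance,
    fun c b i => (⟨xx n P c (l i) (b i) % W, Nat.mod_lt _ hW⟩,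
      ⟨b i % l i ^ (xx n P c (l i) (b i) % W + L), ?_⟩), ?_, ?_, ?_⟩
  · have h1 := hl i
    refine (Nat.mod_lt _ (by positivity)).trans_le (Nat.pow_le_pow_right (by omega) ?_)
    have := Nat.mod_lt (xx n P c (l i) (b i)) hW
    omega
  · intro b
    by_contra hcon
    push Not at hcon
    choose f hf using hcon
    have hinj : Function.Injective f := by
      intro c c' hcc
      have h1 := bad_unique (by omega) (by omega) (not_lt.2 (hf c))
      have h2 := bad_unique (by omega) (by omega) (not_lt.2 (hf c'))
      rw [hcc] at h1
      ext
      omega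
    have := Fintype.card_le_of_injective f hinj
    simp at this
  · intro c b b' hb hb' hD
    funext i
    obtain ⟨s, t, hs, ht, h⟩ := hD i
    have := tree_key (hl i) (show (c : ℕ) ≤ n by omega) (show L < P by omega) hs ht h (hb i) (hb' i)
    exact Prod.ext this.1 this.2
  · intro c b b' hk hcode
    funext i
    have h1 := congrFun hk i
    have h2 := congrFun hcode i
    simp only [Prod.mk.injEq, Fin.mk.injEq] at h1 h2
    rw [h2.1] at h1 h2
    rw [← Nat.div_add_mod (b i) (l i ^ (xx n P c (l i) (b' i) % W + L)), h1.2, h2.2, Nat.div_add_mod]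

lemma D_two {d n : ℕ} (l : Fin n → ℕ) (C : ℕ) (F : (Fin d → ℕ) → (Fin n → ℕ))
    (hF : ∀ a i, D l C (F a) (F (Function.update a i (a i + 1)))) (s : Finset (Fin d)) :
    ∀ z z' : Fin d → ℕ, (∀ j, j ∉ s → z j = z' j) → (∀ j, z j ≤ z' j + 2 ∧ z' j ≤ z j + 2) →
      D l (2 * C * s.card) (F z) (F z') := by
  induction s using Finset.induction_on with
  | empty =>
    intro z z' h _
    have : z = z' := funext fun j => h j (by simp)
    subst this
    exact D.refl _ _
  | insert a s ha ih =>
    intro z z' h h2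
    have key : ∀ (y : Fin d → ℕ) (t : ℕ), y a ≤ t → t ≤ y a + 2 → D l (2 * C) (F y) (F (Function.update y a t)) := by
      intro y t h1 h2
      obtain rfl | rfl | rfl : t = y a ∨ t = y a + 1 ∨ t = y a + 2 := by omega
      · rw [Function.update_eq_self]; exact (D.refl _ _).mono (by omega)
      · exact (hF y a).mono (by omega)
      · have h3 := (hF y a).trans (hF _ a)
        rw [Function.update_self, Function.update_idem] at h3
        exact h3.mono (by omega)
    have h3 : D l (2 * C) (F z) (F (Function.update z a (z' a))) := by
      rcases le_total (z a) (z' a) with hle | hle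
      · exact key z _ hle (h2 a).2
      · have := key (Function.update z a (z' a)) (z a) (by simpa using hle) (by simpa using (h2 a).1)
        rw [Function.update_idem, Function.update_eq_self] at this
        exact this.symm
    have h4 := ih (Function.update z a (z' a)) z' (fun j hj => ?_) (fun j => ?_)
    · refine (h3.trans h4).mono ?_
      rw [Finset.card_insert_of_notMem ha]
      ring_nf; omega
    · by_cases hja : j = a
      · subst hja; simp
      · simp [hja]; exact h j (by simp [hja, hj])
    · by_cases hja : j = a
      · subst hja; simp
      · simpa [hja] using h2 j

theorem no_embed (n : ℕ) (l : Fin n → ℕ) (hl : ∀ i, 2 ≤ l i) (C : ℕ)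
    (F : (Fin (n+1) → ℕ) → (Fin n → ℕ)) (hinj : Function.Injective F)
    (hF : ∀ a i, D l C (F a) (F (Function.update a i (a i + 1)))) : False := by
  classical
  obtain ⟨good, key, X, _, code, hgood, hkey, hcode⟩ := coloring n l hl (2 * C * (n+1))
  have hD2 : ∀ z z' : Fin (n+1) → ℕ, (∀ j, z j ≤ z' j + 2 ∧ z' j ≤ z j + 2) →
      D l (2 * C * (n+1)) (F z) (F z') := by
    intro z z' h
    have := D_two l C F hF univ z z' (by simp) h
    simpa using this
  let step : Fin (n+1) → (Fin (n+1) → ℕ) → (Fin (n+1) → ℕ) → Prop := fun i z z' =>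
    good i (F z) ∧ good i (F z') ∧ ∀ j, z j ≤ z' j + 2 ∧ z' j ≤ z j + 2
  let reach : Fin (n+1) → (Fin (n+1) → ℕ) → Prop := fun i z =>
    ∃ z0, good i (F z0) ∧ z0 i = 0 ∧ Relation.ReflTransGen (step i) z0 z
  set M := Fintype.card X
  have hbound : ∀ i z, reach i z → z i ≤ 2 * M + 3 := by
    rintro i z ⟨z0, hg0, hz0, hr⟩
    have hk : ∀ w, Relation.ReflTransGen (step i) z0 w → key i (F w) = key i (F z0) := by
      intro w hw
      induction hw with
      | refl => rfl
      | tail _ h ih => rw [← ih]; exact (hkey i _ _ h.1 h.2.1 (hD2 _ _ h.2.2)).symm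
    have hivt : ∀ w, Relation.ReflTransGen (step i) z0 w → ∀ τ, 2 * (τ + 1) ≤ w i →
        ∃ y, Relation.ReflTransGen (step i) z0 y ∧ y i / 2 = τ + 1 := by
      intro w hw
      induction hw with
      | refl => intro τ h; omega
      | @tail b c hb h ih =>
        intro τ hτ
        by_cases h1 : 2 * (τ + 1) ≤ b i
        · exact ih τ h1
        · have := h.2.2 i
          exact ⟨c, hb.tail h, by omega⟩
    by_contra hcon
    have hex : ∀ τ : Fin (M+1), ∃ y, Relation.ReflTransGen (step i) z0 y ∧ y i / 2 = τ + 1 :=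
      fun τ => hivt z hr τ (by omega)
    choose y hy1 hy2 using hex
    have : Function.Injective (fun τ => code i (F (y τ))) := by
      intro τ τ' h
      have h1 := hcode i _ _ ((hk _ (hy1 τ)).trans (hk _ (hy1 τ')).symm) h
      have h2 := hy2 τ
      rw [hinj h1, hy2 τ'] at h2
      ext; omega
    have := Fintype.card_le_of_injective _ this
    simp [M] at this
  let U : Fin (n+1) → (Fin (n+1) → ℕ) → Prop := fun i v =>
    v i = 0 ∨ ∃ z, reach i z ∧ ∀ j, z j ≤ v j + 1 ∧ v j ≤ z j + 1
  set R := 2 * M + 5 with hR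
  refine hex (R := R) (by omega) (fun i v => if U i v then 0 else (R : ℤ)) ?_ ?_
  · intro i
    refine ⟨fun x hx => if_pos (Or.inl hx), fun x hx => if_neg ?_⟩
    rintro (h | ⟨z, hz, h⟩)
    · omega
    · have := hbound i z hz
      have := h i
      omega
  · intro v
    obtain ⟨i, hi⟩ := hgood (F v)
    refine ⟨i, if reach i v then 0 else R, ?_⟩
    intro w hw
    have : U i w ↔ reach i v := by
      constructor
      · rintro (h | ⟨z, ⟨z0, hg0, hz0, hr⟩, h⟩)
        · exact ⟨v, hi, by have := hw i; omega, .refl⟩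
        · refine ⟨z0, hg0, hz0, hr.tail ⟨?_, hi, ?_⟩⟩
          · cases hr with
            | refl => exact hg0
            | tail _ h => exact h.2.1
          · intro j
            have := h j
            have := hw j
            omega
      · intro h
        exact Or.inr ⟨v, h, fun j => by have := hw j; omega⟩
    simp only [this]

theorem comb {m n : ℕ} (l : Fin n → ℕ) (hl : ∀ i, 2 ≤ l i) (C : ℕ)
    (σ τ : Fin m → (Fin n → ℕ) → (Fin n → ℕ))
    (hσ : ∀ i, Function.Injective (σ i))
    (hd : ∀ i b b', σ i b ≠ τ i b')
    (c1 : ∀ i j, i ≠ j → ∀ b, σ i (σ j b) = σ j (σ i b))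
    (c2 : ∀ i j, i ≠ j → ∀ b, σ i (τ j b) = τ j (σ i b))
    (c3 : ∀ i j, i ≠ j → ∀ b, τ i (τ j b) = τ j (τ i b))
    (hC : ∀ i b, D l C b (σ i b)) : m ≤ n := by
  by_contra hmn
  have hle : n + 1 ≤ m := by omega
  let s : Fin (n+1) → Function.End (Fin n → ℕ) := fun i => σ (Fin.castLE hle i)
  let t : Fin (n+1) → Function.End (Fin n → ℕ) := fun i => τ (Fin.castLE hle i)
  have hne : ∀ i j : Fin (n+1), i ≠ j → Fin.castLE hle i ≠ Fin.castLE hle j := by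
    intro i j h h'; exact h (by simpa using h')
  have k1 : ∀ i j, i ≠ j → Commute (s i) (s j) := fun i j h => funext fun b => c1 _ _ (hne i j h) b
  have k2 : ∀ i j, i ≠ j → Commute (s i) (t j) := fun i j h => funext fun b => c2 _ _ (hne i j h) b
  have k3 : ∀ i j, i ≠ j → Commute (t i) (t j) := fun i j h => funext fun b => c3 _ _ (hne i j h) b
  have comm : ∀ a : Fin (n+1) → ℕ, ((univ : Finset (Fin (n+1))) : Set (Fin (n+1))).Pairwise
      (Function.onFun Commute (fun i => s i ^ a i * t i)) := by
    intro a i _ j _ hij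
    have h1 := (k1 i j hij).pow_pow (a i) (a j)
    have h2 := (k2 i j hij).pow_left (a i)
    have h3 := ((k2 j i hij.symm).pow_left (a j)).symm
    exact (h1.mul_right h2).mul_left (h3.mul_right (k3 i j hij))
  let Fe : (Fin (n+1) → ℕ) → Function.End (Fin n → ℕ) := fun a =>
    univ.noncommProd (fun i => s i ^ a i * t i) (comm a)
  have hFe : ∀ a i, ∃ r : Function.End (Fin n → ℕ), ∀ x, Fe (Function.update a i x) = s i ^ x * t i * r := by
    intro a i
    refine ⟨(univ.erase i).noncommProd (fun i => s i ^ a i * t i) ((comm a).mono (by simp)), ?_⟩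
    intro x
    show univ.noncommProd _ _ = _
    rw [← Finset.mul_noncommProd_erase univ (mem_univ i) _ (comm (Function.update a i x))]
    congr 1
    · simp
    · apply Finset.noncommProd_congr rfl
      intro j hj
      rw [Function.update_of_ne (by simpa using hj)]
  have hsinj : ∀ i (x : ℕ), Function.Injective (s i ^ x) := by
    intro i x
    induction x with
    | zero => exact Function.injective_id
    | succ x ih => rw [pow_succ]; exact ih.comp (hσ _)
  refine no_embed n l hl C (fun a => Fe a 0) ?_ ?_
  · intro a a' h
    funext i
    have aux : ∀ a a' : Fin (n+1) → ℕ, Fe a 0 = Fe a' 0 → ¬ a i < a' i := by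
      intro a a' h hlt
      obtain ⟨r, hr⟩ := hFe a i
      obtain ⟨r', hr'⟩ := hFe a' i
      have e1 := hr (a i)
      have e2 := hr' (a' i)
      rw [Function.update_eq_self] at e1 e2
      rw [e1, e2] at h
      obtain ⟨y, hy⟩ : ∃ y, a' i = a i + (1 + y) := ⟨a' i - a i - 1, by omega⟩
      rw [hy, pow_add, pow_add, pow_one, mul_assoc, mul_assoc, mul_assoc, mul_assoc] at h
      have h2 := hsinj i (a i) h
      exact hd _ _ _ h2.symm
    have h1 := aux a a' h
    have h2 := aux a' a h.symm
    omega
  · intro a i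
    obtain ⟨r, hr⟩ := hFe a i
    have e1 := hr (a i)
    have e2 := hr (a i + 1)
    rw [Function.update_eq_self] at e1
    have : Fe (Function.update a i (a i + 1)) = s i * Fe a := by
      rw [e1, e2, pow_succ', mul_assoc, mul_assoc, mul_assoc]
    show D l C (Fe a 0) (Fe (Function.update a i (a i + 1)) 0)
    rw [this]
    exact hC _ _
end CTR
namespace CTR
open Finset
open scoped ENNReal

section clarkson

lemma rpow_add_lt {q a b : ℝ} (hq0 : 0 < q) (hq : q < 1) (ha : 0 < a) (hb : 0 < b) :
    (a + b) ^ q < a ^ q + b ^ q := by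
  have hs : 0 < a + b := by positivity
  have e : ∀ x : ℝ, 0 < x → x ^ q = x * x ^ (q - 1) := by
    intro x hx
    rw [Real.rpow_sub_one hx.ne']; field_simp
  rw [e _ hs, e _ ha, e _ hb, add_mul]
  have h1 := Real.rpow_lt_rpow_of_neg ha (show a < a + b by linarith) (show q - 1 < 0 by linarith)
  have h2 := Real.rpow_lt_rpow_of_neg hb (show b < a + b by linarith) (show q - 1 < 0 by linarith)
  have := mul_lt_mul_of_pos_left h1 ha
  have := mul_lt_mul_of_pos_left h2 hb
  linarith

lemma rpow_add_gt {q a b : ℝ} (hq : 1 < q) (ha : 0 < a) (hb : 0 < b) :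
    a ^ q + b ^ q < (a + b) ^ q := by
  have hs : 0 < a + b := by positivity
  have e : ∀ x : ℝ, 0 < x → x ^ q = x * x ^ (q - 1) := by
    intro x hx
    rw [Real.rpow_sub_one hx.ne']; field_simp
  rw [e _ hs, e _ ha, e _ hb, add_mul]
  have h1 := Real.rpow_lt_rpow ha.le (show a < a + b by linarith) (show 0 < q - 1 by linarith)
  have h2 := Real.rpow_lt_rpow hb.le (show b < a + b by linarith) (show 0 < q - 1 by linarith)
  have := mul_lt_mul_of_pos_left h1 ha
  have := mul_lt_mul_of_pos_left h2 hb
  linarith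

lemma norm_rpow_sq (z : ℂ) (r : ℝ) : ‖z‖ ^ r = (‖z‖ ^ 2) ^ (r / 2) := by
  rw [← Real.rpow_natCast, ← Real.rpow_mul (norm_nonneg _)]
  congr 1; push_cast; ring

lemma clarkson_lt {r : ℝ} (h0 : 0 < r) (h2 : r < 2) (z w : ℂ) :
    ‖z + w‖ ^ r + ‖z - w‖ ^ r ≤ 2 * (‖z‖ ^ r + ‖w‖ ^ r) ∧
    (‖z + w‖ ^ r + ‖z - w‖ ^ r = 2 * (‖z‖ ^ r + ‖w‖ ^ r) → z = 0 ∨ w = 0) := by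
  by_cases hz : z = 0
  · subst hz; simp [Real.zero_rpow h0.ne']; linarith
  by_cases hw : w = 0
  · subst hw; simp [Real.zero_rpow h0.ne']; linarith
  suffices h : ‖z + w‖ ^ r + ‖z - w‖ ^ r < 2 * (‖z‖ ^ r + ‖w‖ ^ r) from
    ⟨h.le, fun h' => absurd h' h.ne⟩
  have par := parallelogram_law_with_norm ℝ z w
  simp only [norm_rpow_sq _ r]
  have hzp : 0 < ‖z‖ ^ 2 := by positivity
  have hwp : 0 < ‖w‖ ^ 2 := by positivity
  have h1 := rpow_add_lt (q := r / 2) (by linarith) (by linarith) hzp hwp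
  have h3 := (Real.concaveOn_rpow (p := r / 2) (by linarith) (by linarith)).2
    (Set.mem_Ici.2 (sq_nonneg ‖z + w‖)) (Set.mem_Ici.2 (sq_nonneg ‖z - w‖))
    (show (0:ℝ) ≤ 1/2 by norm_num) (show (0:ℝ) ≤ 1/2 by norm_num) (by norm_num)
  simp only [smul_eq_mul] at h3
  have h4 : 1 / 2 * ‖z + w‖ ^ 2 + 1 / 2 * ‖z - w‖ ^ 2 = ‖z‖ ^ 2 + ‖w‖ ^ 2 := by nlinarith
  rw [h4] at h3
  linarith

lemma clarkson_gt {r : ℝ} (h2 : 2 < r) (z w : ℂ) :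
    2 * (‖z‖ ^ r + ‖w‖ ^ r) ≤ ‖z + w‖ ^ r + ‖z - w‖ ^ r ∧
    (‖z + w‖ ^ r + ‖z - w‖ ^ r = 2 * (‖z‖ ^ r + ‖w‖ ^ r) → z = 0 ∨ w = 0) := by
  have h0 : 0 < r := by linarith
  by_cases hz : z = 0
  · subst hz; simp [Real.zero_rpow h0.ne']; linarith
  by_cases hw : w = 0
  · subst hw; simp [Real.zero_rpow h0.ne']; linarith
  suffices h : 2 * (‖z‖ ^ r + ‖w‖ ^ r) < ‖z + w‖ ^ r + ‖z - w‖ ^ r from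
    ⟨h.le, fun h' => absurd h' h.ne'⟩
  have par := parallelogram_law_with_norm ℝ z w
  simp only [norm_rpow_sq _ r]
  have hzp : 0 < ‖z‖ ^ 2 := by positivity
  have hwp : 0 < ‖w‖ ^ 2 := by positivity
  have h1 := rpow_add_gt (q := r / 2) (by linarith) hzp hwp
  have h3 := (convexOn_rpow (p := r / 2) (by linarith)).2
    (Set.mem_Ici.2 (sq_nonneg ‖z + w‖)) (Set.mem_Ici.2 (sq_nonneg ‖z - w‖))
    (show (0:ℝ) ≤ 1/2 by norm_num) (show (0:ℝ) ≤ 1/2 by norm_num) (by norm_num)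
  simp only [smul_eq_mul] at h3
  have h4 : 1 / 2 * ‖z + w‖ ^ 2 + 1 / 2 * ‖z - w‖ ^ 2 = ‖z‖ ^ 2 + ‖w‖ ^ 2 := by nlinarith
  rw [h4] at h3
  linarith

end clarkson

section lpsec
variable {I : Type*} [DecidableEq I] {p : ℝ≥0∞} [Fact (1 ≤ p)]

lemma toReal_pos (hp : p ≠ ∞) : 0 < p.toReal :=
  ENNReal.toReal_pos (zero_lt_one.trans_le (Fact.out : 1 ≤ p)).ne' hp

lemma one_le_toReal (hp : p ≠ ∞) : 1 ≤ p.toReal := by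
  have := ENNReal.toReal_mono hp (Fact.out : 1 ≤ p)
  simpa using this

/-- basis vector -/
noncomputable abbrev δ (p : ℝ≥0∞) (a : I) : lp (fun _ : I => ℂ) p := lp.single p a (1 : ℂ)

lemma δ_apply (a c : I) : (δ p a : I → ℂ) c = if c = a then 1 else 0 := by
  rw [lp.single_apply, Pi.single_apply]

lemma norm_δ (a : I) : ‖δ p a‖ = 1 := by
  rw [lp.norm_single (zero_lt_one.trans_le (Fact.out : 1 ≤ p))]; simp

lemma coord_le (f : lp (fun _ : I => ℂ) p) (c : I) : ‖(f : I → ℂ) c‖ ≤ ‖f‖ :=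
  lp.norm_apply_le_norm (zero_lt_one.trans_le (Fact.out : 1 ≤ p)).ne' f c

noncomputable def coord (p : ℝ≥0∞) [Fact (1 ≤ p)] (c : I) : lp (fun _ : I => ℂ) p →L[ℂ] ℂ :=
  LinearMap.mkContinuous
    { toFun := fun f => (f : I → ℂ) c
      map_add' := fun f g => by simp
      map_smul' := fun f g => by simp } 1 (fun f => by rw [one_mul]; exact coord_le f c)

lemma coord_apply (c : I) (f : lp (fun _ : I => ℂ) p) : coord p c f = (f : I → ℂ) c := rfl

lemma hasSum_coord (hp : p ≠ ∞) (X : lp (fun _ : I => ℂ) p →L[ℂ] lp (fun _ : I => ℂ) p)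
    (f : lp (fun _ : I => ℂ) p) (c : I) :
    HasSum (fun a => (f : I → ℂ) a * (X (δ p a) : I → ℂ) c) ((X f : I → ℂ) c) := by
  have h := ((coord p c).comp X).hasSum (lp.hasSum_single hp f)
  have e : (fun a => (f : I → ℂ) a * (X (δ p a) : I → ℂ) c) =
      fun a => ((coord p c).comp X) (lp.single p a ((f : I → ℂ) a)) := by
    funext a
    rw [ContinuousLinearMap.comp_apply, coord_apply]
    have : lp.single p a ((f : I → ℂ) a) = (f : I → ℂ) a • δ p a := by
      rw [← lp.single_smul]; simp
    rw [this, map_smul]; simp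
  rw [e]; exact h

lemma exists_of_apply_ne (hp : p ≠ ∞) (X : lp (fun _ : I => ℂ) p →L[ℂ] lp (fun _ : I => ℂ) p)
    (f : lp (fun _ : I => ℂ) p) (c : I) (h : (X f : I → ℂ) c ≠ 0) :
    ∃ a, (f : I → ℂ) a ≠ 0 ∧ (X (δ p a) : I → ℂ) c ≠ 0 := by
  by_contra hcon
  push Not at hcon
  apply h
  have h1 := hasSum_coord hp X f c
  have h2 : (fun a => (f : I → ℂ) a * (X (δ p a) : I → ℂ) c) = fun _ => 0 := by
    funext a
    by_cases ha : (f : I → ℂ) a = 0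
    · simp [ha]
    · simp [hcon a ha]
  rw [h2] at h1
  exact h1.unique hasSum_zero

lemma op_ext (hp : p ≠ ∞) {X Y : lp (fun _ : I => ℂ) p →L[ℂ] lp (fun _ : I => ℂ) p}
    (h : ∀ a, X (δ p a) = Y (δ p a)) : X = Y := by
  ext f c
  have h1 := hasSum_coord hp X f c
  have h2 := hasSum_coord hp Y f c
  simp only [h] at h1
  exact h1.unique h2

lemma disjoint_of_norm (hp : p ≠ ∞) (hp2 : p ≠ 2) (f g : lp (fun _ : I => ℂ) p)
    (h : ‖f + g‖ ^ p.toReal + ‖f - g‖ ^ p.toReal = 2 * (‖f‖ ^ p.toReal + ‖g‖ ^ p.toReal)) (c : I) :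
    (f : I → ℂ) c = 0 ∨ (g : I → ℂ) c = 0 := by
  have hpos := toReal_pos hp
  have hr2 : p.toReal ≠ 2 := by
    intro h
    apply hp2
    rw [← ENNReal.ofReal_toReal hp, h]; simp
  have S : ∀ f : lp (fun _ : I => ℂ) p, HasSum (fun c => ‖(f : I → ℂ) c‖ ^ p.toReal) (‖f‖ ^ p.toReal) :=
    fun f => lp.hasSum_norm hpos f
  have hs := (((S f).add (S g)).mul_left 2).sub ((S (f + g)).add (S (f - g)))
  rw [h, sub_self] at hs
  have key : ∀ c, 2 * (‖(f : I → ℂ) c‖ ^ p.toReal + ‖(g : I → ℂ) c‖ ^ p.toReal) -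
      (‖((f + g : lp (fun _ : I => ℂ) p) : I → ℂ) c‖ ^ p.toReal + ‖((f - g : lp (fun _ : I => ℂ) p) : I → ℂ) c‖ ^ p.toReal) = 0 := by
    rcases lt_or_gt_of_ne hr2 with hlt | hgt
    · have := (hasSum_zero_iff_of_nonneg ?_).1 hs
      · exact fun c => congrFun this c
      · intro c
        have := (clarkson_lt hpos hlt ((f : I → ℂ) c) ((g : I → ℂ) c)).1
        simpa using this
    · have := (hasSum_zero_iff_of_nonneg ?_).1 (neg_zero (G := ℝ) ▸ hs.neg)
      · exact fun c => by
          have := congrFun this c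
          simp at this ⊢
          linarith
      · intro c
        have := (clarkson_gt hgt ((f : I → ℂ) c) ((g : I → ℂ) c)).1
        simpa using this
  have k := key c
  simp only [lp.coeFn_add, lp.coeFn_sub, Pi.add_apply, Pi.sub_apply] at k
  rcases lt_or_gt_of_ne hr2 with hlt | hgt
  · exact (clarkson_lt hpos hlt ((f : I → ℂ) c) ((g : I → ℂ) c)).2 (by linarith)
  · exact (clarkson_gt hgt ((f : I → ℂ) c) ((g : I → ℂ) c)).2 (by linarith)

lemma norm_of_disjoint (hp : p ≠ ∞) (f g : lp (fun _ : I => ℂ) p)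
    (h : ∀ c, (f : I → ℂ) c = 0 ∨ (g : I → ℂ) c = 0) :
    ‖f + g‖ ^ p.toReal = ‖f‖ ^ p.toReal + ‖g‖ ^ p.toReal := by
  have hpos := toReal_pos hp
  have S : ∀ f : lp (fun _ : I => ℂ) p, HasSum (fun c => ‖(f : I → ℂ) c‖ ^ p.toReal) (‖f‖ ^ p.toReal) :=
    fun f => lp.hasSum_norm hpos f
  have h1 := (S f).add (S g)
  refine (S (f + g)).unique ?_
  convert h1 using 2 with c
  rcases h c with h | h <;> simp [h, Real.zero_rpow hpos.ne']

/-- Lamperti: isometries preserve disjointness. -/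
lemma iso_disjoint (hp : p ≠ ∞) (hp2 : p ≠ 2) (s : lp (fun _ : I => ℂ) p →L[ℂ] lp (fun _ : I => ℂ) p)
    (hs : ∀ f, ‖s f‖ = ‖f‖) (f g : lp (fun _ : I => ℂ) p)
    (h : ∀ c, (f : I → ℂ) c = 0 ∨ (g : I → ℂ) c = 0) (c : I) :
    (s f : I → ℂ) c = 0 ∨ (s g : I → ℂ) c = 0 := by
  apply disjoint_of_norm hp hp2
  rw [← map_add, ← map_sub, hs, hs, hs, hs, norm_of_disjoint hp f g h, sub_eq_add_neg,
    norm_of_disjoint hp f (-g) (by intro c; simpa using h c), norm_neg]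
  ring

theorem weighted (hp : p ≠ ∞) (hp2 : p ≠ 2) {K : ℕ}
    (s t : Fin K → (lp (fun _ : I => ℂ) p →L[ℂ] lp (fun _ : I => ℂ) p))
    (hts : ∀ j, t j * s j = 1) (hts0 : ∀ j j', j ≠ j' → t j * s j' = 0)
    (hsum : ∑ j, s j * t j = 1)
    (hs1 : ∀ j, ‖s j‖ ≤ 1) (ht1 : ∀ j, ‖t j‖ ≤ 1)
    (hsp : ∀ j j', j ≠ j' → ‖s j + s j'‖ ≤ 2 ^ (1 / p.toReal))
    (hsm : ∀ j j', j ≠ j' → ‖s j - s j'‖ ≤ 2 ^ (1 / p.toReal))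
    (htp : ∀ j j', j ≠ j' → ‖t j + t j'‖ ≤ 2 ^ (1 - 1 / p.toReal))
    (htm : ∀ j j', j ≠ j' → ‖t j - t j'‖ ≤ 2 ^ (1 - 1 / p.toReal)) (j : Fin K) (b : I) :
    ∃ (c : I) (ω : ℂ), ‖ω‖ = 1 ∧ s j (δ p b) = ω • δ p c := by
  have hpos := toReal_pos hp
  have ts : ∀ j f, t j (s j f) = f := fun j f => by
    have := congrArg (fun X => X f) (hts j); simpa using this
  have ts0 : ∀ j j', j ≠ j' → ∀ f, t j (s j' f) = 0 := fun j j' h f => by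
    have := congrArg (fun X => X f) (hts0 j j' h); simpa using this
  have iso : ∀ j f, ‖s j f‖ = ‖f‖ := by
    intro j f
    apply le_antisymm
    · simpa using (s j).le_of_opNorm_le (hs1 j) f
    · have := (t j).le_of_opNorm_le (ht1 j) (s j f)
      rw [ts] at this; simpa using this
  have hd1 : ∀ j b b' c, b ≠ b' → (s j (δ p b) : I → ℂ) c = 0 ∨ (s j (δ p b') : I → ℂ) c = 0 := by
    intro j b b' c hb
    apply iso_disjoint hp hp2 _ (iso j)
    intro d
    rw [δ_apply, δ_apply]
    by_cases h : d = b
    · right; rw [if_neg]; rintro rfl; exact hb h.symm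
    · left; rw [if_neg h]
  have e2 : (2 : ℝ) ^ (1 - 1 / p.toReal) * 2 ^ (1 / p.toReal) = 2 := by
    rw [← Real.rpow_add (by norm_num)]; simp
  have hd2 : ∀ j j', j ≠ j' → ∀ f c, (s j f : I → ℂ) c = 0 ∨ (s j' f : I → ℂ) c = 0 := by
    intro j j' hj f
    apply disjoint_of_norm hp hp2
    have aux : ∀ g : lp (fun _ : I => ℂ) p, ‖g‖ ≤ 2 ^ (1 / p.toReal) * ‖f‖ →
        2 * ‖f‖ ≤ 2 ^ (1 - 1 / p.toReal) * ‖g‖ → ‖g‖ ^ p.toReal = 2 * ‖f‖ ^ p.toReal := by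
      intro g h1 h2
      have h3 : ‖g‖ = 2 ^ (1 / p.toReal) * ‖f‖ := by
        apply le_antisymm h1
        have hp' : (0 : ℝ) < 2 ^ (1 - 1 / p.toReal) := by positivity
        rw [← mul_le_mul_iff_right₀ hp', ← mul_assoc, e2]
        exact h2
      rw [h3, Real.mul_rpow (by positivity) (norm_nonneg _), ← Real.rpow_mul (by norm_num),
        one_div_mul_cancel hpos.ne', Real.rpow_one]
    have a1 := aux (s j f + s j' f) ((s j + s j').le_of_opNorm_le (hsp j j' hj) f) (by
      have := (t j + t j').le_of_opNorm_le (htp j j' hj) (s j f + s j' f)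
      have e : (t j + t j') (s j f + s j' f) = (2 : ℂ) • f := by
        simp [ts, ts0 j j' hj, ts0 j' j hj.symm, two_smul]
      rw [e, norm_smul] at this
      simpa using this)
    have a2 := aux (s j f - s j' f) ((s j - s j').le_of_opNorm_le (hsm j j' hj) f) (by
      have := (t j - t j').le_of_opNorm_le (htm j j' hj) (s j f - s j' f)
      have e : (t j - t j') (s j f - s j' f) = (2 : ℂ) • f := by
        simp [ts, ts0 j j' hj, ts0 j' j hj.symm, two_smul]
      rw [e, norm_smul] at this
      simpa using this)
    rw [a1, a2, iso, iso]; ring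
  have hd3 : ∀ j j', j ≠ j' → ∀ b b' c, (s j (δ p b) : I → ℂ) c = 0 ∨ (s j' (δ p b') : I → ℂ) c = 0 := by
    intro j j' hj b b' c
    by_cases hb : b = b'
    · subst hb; exact hd2 j j' hj _ c
    · have h1 := hd2 j j' hj (δ p b + δ p b') c
      have h2 := hd1 j b b' c hb
      have h3 := hd1 j' b b' c hb
      simp only [map_add, lp.coeFn_add, Pi.add_apply] at h1
      rcases h2 with h2 | h2 <;> rcases h3 with h3 | h3 <;> simp_all
  have hd4 : ∀ j j', j ≠ j' → ∀ f g c, (s j f : I → ℂ) c = 0 ∨ (s j' g : I → ℂ) c = 0 := by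
    intro j j' hj f g c
    by_contra hcon
    push Not at hcon
    obtain ⟨a, _, ha⟩ := exists_of_apply_ne hp _ _ _ hcon.1
    obtain ⟨a', _, ha'⟩ := exists_of_apply_ne hp _ _ _ hcon.2
    rcases hd3 j j' hj a a' c with h | h <;> contradiction
  -- choose c in the support
  obtain ⟨c, hc⟩ : ∃ c, (s j (δ p b) : I → ℂ) c ≠ 0 := by
    by_contra hcon
    push Not at hcon
    have : s j (δ p b) = 0 := by ext c; simpa using hcon c
    have h2 := iso j (δ p b)
    rw [this, norm_δ, norm_zero] at h2
    exact zero_ne_one h2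
  have hsumc : ∀ d, ∑ j', (s j' (t j' (δ p c)) : I → ℂ) d = (δ p c : I → ℂ) d := by
    intro d
    have h1 := congrArg (fun X => coord p d (X (δ p c))) hsum
    simp only [ContinuousLinearMap.sum_apply, map_sum] at h1
    exact h1
  have hst : s j (t j (δ p c)) = δ p c := by
    ext d
    rw [← hsumc d]
    by_cases hdc : d = c
    · subst hdc
      rw [Finset.sum_eq_single j]
      · intro j' _ hj'
        rcases hd4 j' j hj' (t j' (δ p d)) (δ p b) d with h | h
        · exact h
        · exact absurd h hc
      · simp
    · have h0 : ∀ j', (s j' (t j' (δ p c)) : I → ℂ) d = 0 := by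
        by_contra hcon
        push Not at hcon
        obtain ⟨j0, hj0⟩ := hcon
        have := hsumc d
        rw [Finset.sum_eq_single j0, δ_apply, if_neg hdc] at this
        · exact hj0 this
        · intro j' _ hj'
          rcases hd4 j' j0 hj' (t j' (δ p c)) (t j0 (δ p c)) d with h | h
          · exact h
          · exact absurd h hj0
        · simp
      simp [h0]
  set h := t j (δ p c) with hh
  have hb : (h : I → ℂ) b ≠ 0 := by
    have h1 : (s j h : I → ℂ) c ≠ 0 := by rw [hst, δ_apply]; simp
    obtain ⟨a, ha, ha'⟩ := exists_of_apply_ne hp _ _ _ h1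
    by_cases hab : a = b
    · rwa [hab] at ha
    · rcases hd1 j a b c hab with h | h <;> contradiction
  have hdis : ∀ d, (s j ((h : I → ℂ) b • δ p b) : I → ℂ) d = 0 ∨ (s j (h - (h : I → ℂ) b • δ p b) : I → ℂ) d = 0 := by
    apply iso_disjoint hp hp2 _ (iso j)
    intro d
    simp only [lp.coeFn_smul, lp.coeFn_sub, Pi.smul_apply, Pi.sub_apply, δ_apply, smul_eq_mul]
    by_cases hdb : d = b
    · subst hdb; right; simp
    · left; simp [hdb]
  have hadd : s j ((h : I → ℂ) b • δ p b) + s j (h - (h : I → ℂ) b • δ p b) = δ p c := by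
    rw [← map_add, ← hst]; congr 1; abel
  have hrest : s j ((h : I → ℂ) b • δ p b) = δ p c := by
    ext d
    have e := congrArg (fun f : lp (fun _ : I => ℂ) p => (f : I → ℂ) d) hadd
    simp only [lp.coeFn_add, Pi.add_apply] at e
    rcases hdis d with h1 | h1
    · by_cases hdc : d = c
      · subst hdc
        exfalso
        rw [map_smul] at h1
        simp only [lp.coeFn_smul, Pi.smul_apply, smul_eq_mul, mul_eq_zero] at h1
        rcases h1 with h1 | h1 <;> contradiction
      · rw [h1, δ_apply, if_neg hdc]
    · rw [h1, add_zero] at e; exact e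
  have hfin : s j (δ p b) = ((h : I → ℂ) b)⁻¹ • δ p c := by
    rw [← hrest, map_smul, smul_smul, inv_mul_cancel₀ hb, one_smul]
  refine ⟨c, _, ?_, hfin⟩
  have := iso j (δ p b)
  rw [hfin, norm_smul, norm_δ, norm_δ, mul_one] at this
  exact this

/-- Norm facts on the source side. -/
theorem source_norms (hp : p ≠ ∞) {K : ℕ}
    (S T : Fin K → (lp (fun _ : I => ℂ) p →L[ℂ] lp (fun _ : I => ℂ) p))
    (e : Fin K × I ≃ I)
    (hS : ∀ j a, S j (δ p a) = δ p (e (j, a)))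
    (hT : ∀ j a, T j (δ p (e (j, a))) = δ p a)
    (hT0 : ∀ j j' a, j ≠ j' → T j (δ p (e (j', a))) = 0) :
    (∀ j, T j * S j = 1) ∧ (∀ j j', j ≠ j' → T j * S j' = 0) ∧ (∑ j, S j * T j = 1) ∧
    (∀ j, ‖S j‖ ≤ 1) ∧ (∀ j, ‖T j‖ ≤ 1) ∧
    (∀ j j', j ≠ j' → ‖S j + S j'‖ ≤ 2 ^ (1 / p.toReal)) ∧
    (∀ j j', j ≠ j' → ‖S j - S j'‖ ≤ 2 ^ (1 / p.toReal)) ∧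
    (∀ j j', j ≠ j' → ‖T j + T j'‖ ≤ 2 ^ (1 - 1 / p.toReal)) ∧
    (∀ j j', j ≠ j' → ‖T j - T j'‖ ≤ 2 ^ (1 - 1 / p.toReal)) := by
  have hpos := toReal_pos hp
  have h1 : ∀ j, T j * S j = 1 := fun j => op_ext hp fun a => by
    show T j (S j (δ p a)) = δ p a
    rw [hS, hT]
  have h2 : ∀ j j', j ≠ j' → T j * S j' = 0 := fun j j' hj => op_ext hp fun a => by
    show T j (S j' (δ p a)) = 0
    rw [hS, hT0 _ _ _ hj]
  have h3 : ∑ j, S j * T j = 1 := op_ext hp fun a => by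
    obtain ⟨⟨j0, b⟩, rfl⟩ := e.surjective a
    rw [ContinuousLinearMap.sum_apply, Finset.sum_eq_single j0]
    · show S j0 (T j0 _) = δ p (e (j0, b))
      rw [hT, hS]
    · intro j _ hj
      show S j (T j _) = 0
      rw [hT0 _ _ _ hj, map_zero]
    · simp
  have ts : ∀ j f, T j (S j f) = f := fun j f => by
    have := congrArg (fun X => X f) (h1 j); simpa using this
  have ts0 : ∀ j j', j ≠ j' → ∀ f, T j (S j' f) = 0 := fun j j' h f => by
    have := congrArg (fun X => X f) (h2 j j' h); simpa using this
  have hTc : ∀ j f b, (T j f : I → ℂ) b = (f : I → ℂ) (e (j, b)) := by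
    intro j f b
    have hs := hasSum_coord hp (T j) f b
    refine hs.unique ?_
    convert hasSum_single (e (j, b)) ?_ using 1
    · rw [hT, δ_apply]; simp
    · intro a ha
      obtain ⟨⟨j0, b0⟩, rfl⟩ := e.surjective a
      by_cases hj : j = j0
      · subst hj
        rw [hT, δ_apply, if_neg, mul_zero]
        rintro rfl; exact ha rfl
      · rw [hT0 _ _ _ hj]; simp
  have hstar : ∀ g : lp (fun _ : I => ℂ) p, ‖g‖ ^ p.toReal = ∑ j, ‖T j g‖ ^ p.toReal := by
    intro g
    have s1 := (e.hasSum_iff (f := fun c => ‖(g : I → ℂ) c‖ ^ p.toReal)).2 (lp.hasSum_norm hpos g)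
    have s2 := s1.prod_fiberwise (g := fun j => ‖T j g‖ ^ p.toReal) (fun j => by
      have := lp.hasSum_norm hpos (T j g)
      simpa [hTc] using this)
    exact s2.unique (hasSum_fintype _)
  have hle2 : ∀ j j', j ≠ j' → ∀ g, ‖T j g‖ ^ p.toReal + ‖T j' g‖ ^ p.toReal ≤ ‖g‖ ^ p.toReal := by
    intro j j' hj g
    rw [hstar g, ← Finset.sum_pair hj (f := fun j => ‖T j g‖ ^ p.toReal)]
    exact Finset.sum_le_sum_of_subset_of_nonneg (Finset.subset_univ _) (fun _ _ _ => by positivity)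
  have rle : ∀ {x y : ℝ}, 0 ≤ x → 0 ≤ y → x ^ p.toReal ≤ y ^ p.toReal → x ≤ y :=
    fun hx hy h => (Real.rpow_le_rpow_iff hx hy hpos).1 h
  have hSn : ∀ j j', j ≠ j' → ∀ f g : lp (fun _ : I => ℂ) p, ‖S j f + S j' g‖ ^ p.toReal = ‖f‖ ^ p.toReal + ‖g‖ ^ p.toReal := by
    intro j j' hj f g
    rw [hstar, ← Finset.sum_subset (Finset.subset_univ {j, j'}), Finset.sum_pair hj]
    · simp [ts, ts0 j j' hj, ts0 j' j hj.symm]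
    · intro k _ hk
      simp only [Finset.mem_insert, Finset.mem_singleton, not_or] at hk
      simp [ts0 k j hk.1, ts0 k j' hk.2, Real.zero_rpow hpos.ne']
  have e4 : ∀ f : lp (fun _ : I => ℂ) p, (2 ^ (1 / p.toReal) * ‖f‖) ^ p.toReal = ‖f‖ ^ p.toReal + ‖f‖ ^ p.toReal := by
    intro f
    rw [Real.mul_rpow (by positivity) (norm_nonneg _), ← Real.rpow_mul (by norm_num),
        one_div_mul_cancel hpos.ne', Real.rpow_one]; ring
  have hTT : ∀ j j', j ≠ j' → ∀ f, ‖T j f‖ + ‖T j' f‖ ≤ 2 ^ (1 - 1 / p.toReal) * ‖f‖ := by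
    intro j j' hj f
    apply rle (by positivity) (by positivity)
    have h : (‖T j f‖ + ‖T j' f‖) ^ p.toReal ≤
        2 ^ (p.toReal - 1) * (‖T j f‖ ^ p.toReal + ‖T j' f‖ ^ p.toReal) := by
      have := NNReal.rpow_add_le_mul_rpow_add_rpow ‖T j f‖₊ ‖T j' f‖₊ (one_le_toReal hp)
      exact_mod_cast this
    refine h.trans ?_
    rw [Real.mul_rpow (by positivity) (norm_nonneg _), ← Real.rpow_mul (by norm_num), sub_mul,
        one_div_mul_cancel hpos.ne', one_mul]
    exact mul_le_mul_of_nonneg_left (hle2 j j' hj f) (by positivity)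
  refine ⟨h1, h2, h3, ?_, ?_, ?_, ?_, ?_, ?_⟩
  · intro j
    refine ContinuousLinearMap.opNorm_le_bound _ zero_le_one fun f => ?_
    rw [one_mul]
    apply rle (norm_nonneg _) (norm_nonneg _)
    rw [hstar (S j f), Finset.sum_eq_single j]
    · rw [ts]
    · intro k _ hk
      rw [ts0 k j hk, norm_zero, Real.zero_rpow hpos.ne']
    · simp
  · intro j
    refine ContinuousLinearMap.opNorm_le_bound _ zero_le_one fun f => ?_
    rw [one_mul]
    apply rle (norm_nonneg _) (norm_nonneg _)
    rw [hstar f]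
    exact Finset.single_le_sum (f := fun j => ‖T j f‖ ^ p.toReal) (fun _ _ => by positivity) (Finset.mem_univ j)
  · intro j j' hj
    refine ContinuousLinearMap.opNorm_le_bound _ (by positivity) fun f => ?_
    apply rle (norm_nonneg _) (by positivity)
    rw [e4, ContinuousLinearMap.add_apply, hSn j j' hj]
  · intro j j' hj
    refine ContinuousLinearMap.opNorm_le_bound _ (by positivity) fun f => ?_
    apply rle (norm_nonneg _) (by positivity)
    rw [e4, ContinuousLinearMap.sub_apply, sub_eq_add_neg, ← map_neg, hSn j j' hj, norm_neg]
  · intro j j' hj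
    refine ContinuousLinearMap.opNorm_le_bound _ (by positivity) fun f => ?_
    exact (norm_add_le _ _).trans (hTT j j' hj f)
  · intro j j' hj
    refine ContinuousLinearMap.opNorm_le_bound _ (by positivity) fun f => ?_
    exact (norm_sub_le _ _).trans (hTT j j' hj f)

end lpsec
end CTR
namespace CTR
open scoped ENNReal

section fin

variable {p : ℝ≥0∞} [Fact (1 ≤ p)]

lemma D_update {n : ℕ} (l : Fin n → ℕ) (i : Fin n) (a : Fin n → ℕ) (c j : ℕ) (hj : j < l i)
    (h : a i = l i * c + j) : D l 1 a (Function.update a i c) := by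
  intro i'
  by_cases hi : i' = i
  · subst hi
    refine ⟨1, 0, le_rfl, zero_le_one, ?_⟩
    simp only [pow_one, pow_zero, Nat.div_one, Function.update_self]
    rw [h, Nat.mul_add_div (by omega), Nat.div_eq_of_lt hj, add_zero]
  · refine ⟨0, 0, zero_le_one, zero_le_one, ?_⟩
    rw [Function.update_of_ne hi]

lemma lip {n : ℕ} (hp : p ≠ ∞) (l : Fin n → ℕ)
    (S' T' : ∀ i : Fin n, Fin (l i) →
      (lp (fun _ : Fin n → ℕ => ℂ) p →L[ℂ] lp (fun _ : Fin n → ℕ => ℂ) p))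
    (hS' : ∀ (i : Fin n) (j : Fin (l i)) (a : Fin n → ℕ),
      S' i j (δ p a) = δ p (Function.update a i (l i * a i + (j : ℕ))))
    (hT' : ∀ (i : Fin n) (j : Fin (l i)) (a : Fin n → ℕ) (c : ℕ), a i = l i * c + (j : ℕ) →
      T' i j (δ p a) = δ p (Function.update a i c))
    (hT'₀ : ∀ (i : Fin n) (j : Fin (l i)) (a : Fin n → ℕ),
      (¬ ∃ c : ℕ, a i = l i * c + (j : ℕ)) → T' i j (δ p a) = 0)
    (P : lp (fun _ : Fin n → ℕ => ℂ) p →L[ℂ] lp (fun _ : Fin n → ℕ => ℂ) p)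
    (hP : P ∈ Algebra.adjoin ℂ
        ({x | ∃ (i : Fin n) (j : Fin (l i)), x = S' i j ∨ x = T' i j})) :
    ∃ C, ∀ b c, (P (δ p b) : (Fin n → ℕ) → ℂ) c ≠ 0 → D l C b c := by
  induction hP using Algebra.adjoin_induction with
  | mem x hx =>
    obtain ⟨i, j, rfl | rfl⟩ := hx
    · refine ⟨1, fun b c h => ?_⟩
      rw [hS', δ_apply] at h
      have hc : c = Function.update b i (l i * b i + (j : ℕ)) := by
        by_contra hcon; simp [hcon] at h
      apply D.symm
      have := D_update l i c (b i) j j.2 (by rw [hc]; simp)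
      rw [hc, Function.update_idem, Function.update_eq_self] at this
      rw [hc]; exact this
    · refine ⟨1, fun b c h => ?_⟩
      by_cases hb : ∃ c : ℕ, b i = l i * c + (j : ℕ)
      · obtain ⟨d, hd⟩ := hb
        rw [hT' i j b d hd, δ_apply] at h
        have hc : c = Function.update b i d := by
          by_contra hcon; simp [hcon] at h
        rw [hc]
        exact D_update l i b d j j.2 hd
      · rw [hT'₀ i j b hb] at h
        simp at h
  | algebraMap r =>
    refine ⟨0, fun b c h => ?_⟩
    rw [Algebra.algebraMap_eq_smul_one] at h
    have h' : r * (δ p b : (Fin n → ℕ) → ℂ) c ≠ 0 := h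
    rw [δ_apply] at h'
    have hc : c = b := by
      by_contra hcon; simp [hcon] at h'
    rw [hc]; exact D.refl l b
  | add x y _ _ hx hy =>
    obtain ⟨C1, h1⟩ := hx
    obtain ⟨C2, h2⟩ := hy
    refine ⟨max C1 C2, fun b c h => ?_⟩
    have h' : (x (δ p b) : (Fin n → ℕ) → ℂ) c + (y (δ p b) : (Fin n → ℕ) → ℂ) c ≠ 0 := h
    by_cases hx : (x (δ p b) : (Fin n → ℕ) → ℂ) c = 0
    · rw [hx, zero_add] at h'
      exact (h2 b c h').mono (le_max_right _ _)
    · exact (h1 b c hx).mono (le_max_left _ _)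
  | mul x y _ _ hx hy =>
    obtain ⟨C1, h1⟩ := hx
    obtain ⟨C2, h2⟩ := hy
    refine ⟨C2 + C1, fun b c h => ?_⟩
    have h' : (x (y (δ p b)) : (Fin n → ℕ) → ℂ) c ≠ 0 := h
    obtain ⟨a, ha, ha'⟩ := exists_of_apply_ne hp x _ c h'
    exact (h2 b a ha).trans (h1 a c ha')

lemma smul_δ_inj {I : Type*} [DecidableEq I] {ω ω' : ℂ} {c c' : I} (hω : ‖ω‖ = 1)
    (h : ω • δ p c = ω' • δ p c') : c = c' := by
  by_contra hcon
  have h1 : ω * (δ p c : I → ℂ) c = ω' * (δ p c' : I → ℂ) c :=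
    congrArg (fun f : lp (fun _ : I => ℂ) p => (f : I → ℂ) c) h
  rw [δ_apply, δ_apply, if_pos rfl, if_neg hcon, mul_one, mul_zero] at h1
  rw [h1] at hω; simp at hω

/-- digit splitting in coordinate `i` -/
noncomputable def spl {m : ℕ} (k : Fin m → ℕ) (i : Fin m) (hk : 2 ≤ k i) :
    Fin (k i) × (Fin m → ℕ) ≃ (Fin m → ℕ) :=
  Equiv.ofBijective (fun x => Function.update x.2 i (k i * x.2 i + (x.1 : ℕ))) (by
    constructor
    · rintro ⟨j, a⟩ ⟨j', a'⟩ h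
      simp only at h
      have h0 := congrFun h i
      simp only [Function.update_self] at h0
      have hj := j.2
      have hj' := j'.2
      have e1 : a i = a' i := by
        have := congrArg (· / k i) h0
        simpa [Nat.mul_add_div (show 0 < k i by omega), Nat.div_eq_of_lt hj,
          Nat.div_eq_of_lt hj'] using this
      have e2 : j = j' := by
        apply Fin.ext
        rw [e1] at h0; omega
      have e3 : a = a' := by
        funext i'
        by_cases hi : i' = i
        · rw [hi, e1]
        · have := congrFun h i'
          rwa [Function.update_of_ne hi, Function.update_of_ne hi] at this
      rw [e2, e3]
    · intro a
      refine ⟨⟨⟨a i % k i, Nat.mod_lt _ (by omega)⟩, Function.update a i (a i / k i)⟩, ?_⟩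
      simp only [Function.update_self, Function.update_idem]
      rw [Nat.div_add_mod, Function.update_eq_self])

lemma spl_apply {m : ℕ} (k : Fin m → ℕ) (i : Fin m) (hk : 2 ≤ k i) (j : Fin (k i))
    (a : Fin m → ℕ) : spl k i hk (j, a) = Function.update a i (k i * a i + (j : ℕ)) := rfl

end fin
end CTR
open scoped ENNReal

theorem main_aux
    (p : ℝ≥0∞) [Fact (1 ≤ p)] (hp_top : p ≠ ∞) (hp_two : p ≠ 2)
    (m n : ℕ) (hm : 1 ≤ m) (hn : 1 ≤ n)
    (k : Fin m → ℕ) (hk : ∀ i, 2 ≤ k i)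
    (l : Fin n → ℕ) (hl : ∀ i, 2 ≤ l i)
    (S T : ∀ i : Fin m, Fin (k i) →
      (lp (fun _ : Fin m → ℕ => ℂ) p →L[ℂ] lp (fun _ : Fin m → ℕ => ℂ) p))
    (hS : ∀ (i : Fin m) (j : Fin (k i)) (a : Fin m → ℕ),
      S i j (lp.single p a 1) = lp.single p (Function.update a i (k i * a i + (j : ℕ))) 1)
    (hT : ∀ (i : Fin m) (j : Fin (k i)) (a : Fin m → ℕ) (c : ℕ), a i = k i * c + (j : ℕ) →
      T i j (lp.single p a 1) = lp.single p (Function.update a i c) 1)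
    (hT₀ : ∀ (i : Fin m) (j : Fin (k i)) (a : Fin m → ℕ),
      (¬ ∃ c : ℕ, a i = k i * c + (j : ℕ)) → T i j (lp.single p a 1) = 0)
    (S' T' : ∀ i : Fin n, Fin (l i) →
      (lp (fun _ : Fin n → ℕ => ℂ) p →L[ℂ] lp (fun _ : Fin n → ℕ => ℂ) p))
    (hS' : ∀ (i : Fin n) (j : Fin (l i)) (a : Fin n → ℕ),
      S' i j (lp.single p a 1) = lp.single p (Function.update a i (l i * a i + (j : ℕ))) 1)
    (hT' : ∀ (i : Fin n) (j : Fin (l i)) (a : Fin n → ℕ) (c : ℕ), a i = l i * c + (j : ℕ) →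
      T' i j (lp.single p a 1) = lp.single p (Function.update a i c) 1)
    (hT'₀ : ∀ (i : Fin n) (j : Fin (l i)) (a : Fin n → ℕ),
      (¬ ∃ c : ℕ, a i = l i * c + (j : ℕ)) → T' i j (lp.single p a 1) = 0)
    (A : Subalgebra ℂ (lp (fun _ : Fin m → ℕ => ℂ) p →L[ℂ] lp (fun _ : Fin m → ℕ => ℂ) p))
    (hSA : ∀ i j, S i j ∈ A) (hTA : ∀ i j, T i j ∈ A)
    (ψ : A →ₐ[ℂ] (lp (fun _ : Fin n → ℕ => ℂ) p →L[ℂ] lp (fun _ : Fin n → ℕ => ℂ) p))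
    (hψ : ∀ a, ‖ψ a‖ ≤
      ‖(a : lp (fun _ : Fin m → ℕ => ℂ) p →L[ℂ] lp (fun _ : Fin m → ℕ => ℂ) p)‖)
    (hψB : ∀ a, ψ a ∈ closure ((Algebra.adjoin ℂ
        ({x | ∃ (i : Fin n) (j : Fin (l i)), x = S' i j ∨ x = T' i j}) :
        Subalgebra ℂ (lp (fun _ : Fin n → ℕ => ℂ) p →L[ℂ] lp (fun _ : Fin n → ℕ => ℂ) p)) :
        Set (lp (fun _ : Fin n → ℕ => ℂ) p →L[ℂ] lp (fun _ : Fin n → ℕ => ℂ) p))) :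
    m ≤ n := by
  let aS : ∀ i, Fin (k i) → A := fun i j => ⟨S i j, hSA i j⟩
  let aT : ∀ i, Fin (k i) → A := fun i j => ⟨T i j, hTA i j⟩
  have src := fun i => CTR.source_norms hp_top (S i) (T i) (CTR.spl k i (hk i))
    (fun j a => hS i j a)
    (fun j a => by
      have := hT i j (CTR.spl k i (hk i) (j, a)) (a i) (by
        rw [CTR.spl_apply, Function.update_self])
      rw [CTR.spl_apply, Function.update_idem, Function.update_eq_self] at this
      exact this)
    (fun j j' a hj => by
      apply hT₀ i j
      rintro ⟨c, hc⟩
      rw [CTR.spl_apply, Function.update_self] at hc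
      apply hj
      have h1 := j.2
      have h2 := j'.2
      have e := congrArg (· % k i) hc
      simp only [Nat.mul_add_mod, Nat.mod_eq_of_lt h1, Nat.mod_eq_of_lt h2] at e
      exact Fin.ext e.symm)
  have hw : ∀ i (j : Fin (k i)) b, ∃ (c : Fin n → ℕ) (ω : ℂ), ‖ω‖ = 1 ∧
      ψ (aS i j) (CTR.δ p b) = ω • CTR.δ p c := by
    intro i
    obtain ⟨h1, h2, h3, h4, h5, h6, h7, h8, h9⟩ := src i
    refine CTR.weighted hp_top hp_two (fun j => ψ (aS i j)) (fun j => ψ (aT i j)) ?_ ?_ ?_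
      (fun j => (hψ _).trans (h4 j)) (fun j => (hψ _).trans (h5 j)) ?_ ?_ ?_ ?_
    · intro j
      rw [← map_mul, show aT i j * aS i j = 1 from Subtype.ext (h1 j), map_one]
    · intro j j' hj
      rw [← map_mul, show aT i j * aS i j' = 0 from Subtype.ext (h2 j j' hj), map_zero]
    · simp only [← map_mul, ← map_sum]
      rw [show ∑ j, aS i j * aT i j = 1 from Subtype.ext (by
        rw [AddSubmonoidClass.coe_finsetSum]; exact h3), map_one]
    · intro j j' hj
      rw [← map_add]; exact (hψ _).trans (h6 j j' hj)
    · intro j j' hj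
      rw [← map_sub]; exact (hψ _).trans (h7 j j' hj)
    · intro j j' hj
      rw [← map_add]; exact (hψ _).trans (h8 j j' hj)
    · intro j j' hj
      rw [← map_sub]; exact (hψ _).trans (h9 j j' hj)
  choose f ω hω hf using hw
  have hcomm : ∀ i i', i ≠ i' → ∀ (j : Fin (k i)) (j' : Fin (k i')) b,
      f i j (f i' j' b) = f i' j' (f i j b) := by
    intro i i' hi j j' b
    have h0 : S i j * S i' j' = S i' j' * S i j := CTR.op_ext hp_top fun a => by
      show S i j (S i' j' (lp.single p a 1)) = S i' j' (S i j (lp.single p a 1))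
      rw [hS, hS, hS, hS, Function.update_of_ne hi, Function.update_of_ne hi.symm,
        Function.update_comm hi]
    have h1 : ψ (aS i j) * ψ (aS i' j') = ψ (aS i' j') * ψ (aS i j) := by
      rw [← map_mul, ← map_mul]; congr 1; exact Subtype.ext h0
    have h2 : ψ (aS i j) (ψ (aS i' j') (CTR.δ p b)) = ψ (aS i' j') (ψ (aS i j) (CTR.δ p b)) :=
      congrArg (fun X => X (CTR.δ p b)) h1
    rw [hf, hf, map_smul, map_smul, hf, hf, smul_smul, smul_smul] at h2
    exact CTR.smul_δ_inj (by simp [hω]) h2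
  have hts : ∀ i j b, ψ (aT i j) (ψ (aS i j) (CTR.δ p b)) = CTR.δ p b := by
    intro i j b
    have h : ψ (aT i j) * ψ (aS i j) = 1 := by
      rw [← map_mul, show aT i j * aS i j = 1 from Subtype.ext ((src i).1 j), map_one]
    exact congrArg (fun X => X (CTR.δ p b)) h
  have hts0 : ∀ i j j', j ≠ j' → ∀ b, ψ (aT i j) (ψ (aS i j') (CTR.δ p b)) = 0 := by
    intro i j j' hj b
    have h : ψ (aT i j) * ψ (aS i j') = 0 := by
      rw [← map_mul, show aT i j * aS i j' = 0 from Subtype.ext ((src i).2.1 j j' hj), map_zero]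
    exact congrArg (fun X => X (CTR.δ p b)) h
  have hne : ∀ i j b, ω i j b ≠ 0 := fun i j b h => by
    have := hω i j b
    rw [h] at this; simp at this
  have hδ : ∀ i j b, CTR.δ p (f i j b) = (ω i j b)⁻¹ • ψ (aS i j) (CTR.δ p b) := by
    intro i j b
    rw [hf, smul_smul, inv_mul_cancel₀ (hne i j b), one_smul]
  have hinj : ∀ i j, Function.Injective (f i j) := by
    intro i j b b' hb
    have h1 : (ω i j b)⁻¹ • CTR.δ p b = (ω i j b')⁻¹ • CTR.δ p b' := by
      rw [← hts i j b, ← map_smul, ← hδ, ← hts i j b', ← map_smul, ← hδ, hb]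
    exact CTR.smul_δ_inj (by simp [hω]) h1
  have hdis : ∀ i j j', j ≠ j' → ∀ b b', f i j b ≠ f i j' b' := by
    intro i j j' hj b b' hb
    have h1 : (ω i j b)⁻¹ • CTR.δ p b = 0 := by
      rw [← hts i j b, ← map_smul, ← hδ, hb, hδ, map_smul, hts0 i j j' hj, smul_zero]
    have h2 := congrArg norm h1
    rw [norm_smul, CTR.norm_δ] at h2
    simp [hω] at h2
  have hlip : ∀ i j, ∃ C, ∀ b, CTR.D l C b (f i j b) := by
    intro i j
    obtain ⟨P, hP, hd⟩ := Metric.mem_closure_iff.1 (hψB (aS i j)) 1 one_pos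
    obtain ⟨C, hC⟩ := CTR.lip hp_top l S' T' hS' hT' hT'₀ P hP
    refine ⟨C, fun b => hC _ _ fun h0 => ?_⟩
    have h1 := CTR.coord_le ((ψ (aS i j) - P) (CTR.δ p b)) (f i j b)
    have h2 : (((ψ (aS i j) - P) (CTR.δ p b) : lp (fun _ : Fin n → ℕ => ℂ) p) :
        (Fin n → ℕ) → ℂ) (f i j b) = ω i j b := by
      show ((ψ (aS i j) (CTR.δ p b) : lp (fun _ : Fin n → ℕ => ℂ) p) : (Fin n → ℕ) → ℂ) (f i j b)
        - (P (CTR.δ p b) : (Fin n → ℕ) → ℂ) (f i j b) = ω i j b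
      rw [h0, sub_zero, hf]
      show ω i j b * (CTR.δ p (f i j b) : (Fin n → ℕ) → ℂ) (f i j b) = ω i j b
      rw [CTR.δ_apply, if_pos rfl, mul_one]
    rw [h2, hω] at h1
    have h3 := (ψ (aS i j) - P).le_opNorm (CTR.δ p b)
    rw [CTR.norm_δ, mul_one] at h3
    rw [dist_eq_norm] at hd
    linarith
  choose C hC using hlip
  let z : ∀ i, Fin (k i) := fun i => ⟨0, by have := hk i; omega⟩
  let o : ∀ i, Fin (k i) := fun i => ⟨1, by have := hk i; omega⟩
  have hzo : ∀ i, z i ≠ o i := fun i h => by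
    have := congrArg Fin.val h
    simp [z, o] at this
  exact CTR.comb l hl (Finset.univ.sup fun i => C i (z i)) (fun i => f i (z i)) (fun i => f i (o i))
    (fun i => hinj i _) (fun i b b' => hdis i _ _ (hzo i) b b')
    (fun i j h b => hcomm i j h _ _ b) (fun i j h b => hcomm i j h _ _ b)
    (fun i j h b => hcomm i j h _ _ b)
    (fun i b => (hC i (z i) b).mono
      (Finset.le_sup (f := fun i => C i (z i)) (Finset.mem_univ i)))

/-- Rigidity for tensor products of `L^p`-Cuntz algebras, `p ∈ [1,∞) \ {2}`.  Let
`A ⊆ B(ℓ^p(ℕ^m))` be the smallest closed subalgebra containing the operators `S i j, T i j`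
(for `i : Fin m`, `j : Fin (k i)`) determined on the canonical basis by
`S i j δ_a = δ_{update a i (k i * a i + j)}`, `T i j δ_a = δ_{update a i c}` if
`a i = k i * c + j` and `T i j δ_a = 0` otherwise; this is the canonical concrete realization
of `O_{k 1}^p ⊗_p ⋯ ⊗_p O_{k m}^p`.  Define `B ⊆ B(ℓ^p(ℕ^n))` analogously from alphabet sizes
`l : Fin n → ℕ`.  If there is a unital contractive homomorphism `A → B`, then `m ≤ n`. -/
theorem cuntz_tensor_rigidity
    (p : ℝ≥0∞) [Fact (1 ≤ p)] (hp_top : p ≠ ∞) (hp_two : p ≠ 2)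
    (m n : ℕ) (hm : 1 ≤ m) (hn : 1 ≤ n)
    (k : Fin m → ℕ) (hk : ∀ i, 2 ≤ k i)
    (l : Fin n → ℕ) (hl : ∀ i, 2 ≤ l i)
    (S T : ∀ i : Fin m, Fin (k i) →
      (lp (fun _ : Fin m → ℕ => ℂ) p →L[ℂ] lp (fun _ : Fin m → ℕ => ℂ) p))
    (hS : ∀ (i : Fin m) (j : Fin (k i)) (a : Fin m → ℕ),
      S i j (lp.single p a 1) = lp.single p (Function.update a i (k i * a i + (j : ℕ))) 1)
    (hT : ∀ (i : Fin m) (j : Fin (k i)) (a : Fin m → ℕ) (c : ℕ), a i = k i * c + (j : ℕ) →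
      T i j (lp.single p a 1) = lp.single p (Function.update a i c) 1)
    (hT₀ : ∀ (i : Fin m) (j : Fin (k i)) (a : Fin m → ℕ),
      (¬ ∃ c : ℕ, a i = k i * c + (j : ℕ)) → T i j (lp.single p a 1) = 0)
    (S' T' : ∀ i : Fin n, Fin (l i) →
      (lp (fun _ : Fin n → ℕ => ℂ) p →L[ℂ] lp (fun _ : Fin n → ℕ => ℂ) p))
    (hS' : ∀ (i : Fin n) (j : Fin (l i)) (a : Fin n → ℕ),
      S' i j (lp.single p a 1) = lp.single p (Function.update a i (l i * a i + (j : ℕ))) 1)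
    (hT' : ∀ (i : Fin n) (j : Fin (l i)) (a : Fin n → ℕ) (c : ℕ), a i = l i * c + (j : ℕ) →
      T' i j (lp.single p a 1) = lp.single p (Function.update a i c) 1)
    (hT'₀ : ∀ (i : Fin n) (j : Fin (l i)) (a : Fin n → ℕ),
      (¬ ∃ c : ℕ, a i = l i * c + (j : ℕ)) → T' i j (lp.single p a 1) = 0)
    (φ : (Algebra.adjoin ℂ
        ({x | ∃ (i : Fin m) (j : Fin (k i)), x = S i j ∨ x = T i j})).topologicalClosure →ₐ[ℂ]
      (Algebra.adjoin ℂ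
        ({x | ∃ (i : Fin n) (j : Fin (l i)), x = S' i j ∨ x = T' i j})).topologicalClosure)
    (hφ : ∀ a, ‖φ a‖ ≤ ‖a‖) :
    m ≤ n := by
  exact main_aux p hp_top hp_two m n hm hn k hk l hl S T hS hT hT₀ S' T' hS' hT' hT'₀
    (Algebra.adjoin ℂ
      ({x | ∃ (i : Fin m) (j : Fin (k i)), x = S i j ∨ x = T i j})).topologicalClosure
    (fun i j => (Algebra.adjoin ℂ _).le_topologicalClosure (Algebra.subset_adjoin (by exact ⟨i, j, Or.inl rfl⟩)))
    (fun i j => (Algebra.adjoin ℂ _).le_topologicalClosure (Algebra.subset_adjoin (by exact ⟨i, j, Or.inr rfl⟩)))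
    ((Subalgebra.val _).comp φ) (fun a => hφ a) (fun a => (φ a).2)
end

section
/- Let p ∈ [1, ∞) with p ≠ 2. Let O_2^p ⊆ B(ℓ^p(ℕ)) be the smallest closed subalgebra containing the four operators S_0, S_1, T_0, T_1 determined on the canonical basis by S_j δ_k = δ_{2k+j} and T_j δ_k = δ_l if k = 2l + j and T_j δ_k = 0 otherwise (j ∈ {0,1}). Let D ⊆ B(ℓ^p(ℕ × ℕ)) be the smallest closed subalgebra containing the eight operators S_j ⊗ 1, T_j ⊗ 1, 1 ⊗ S_j, 1 ⊗ T_j (j ∈ {0,1}), where for instance (S_j ⊗ 1) δ_{(k,l)} = δ_{(2k+j, l)} and (1 ⊗ T_j) δ_{(k,l)} = δ_{(k, l')} if l = 2l' + j and 0 otherwise. Then there is no unital contractive algebra homomorphism from D to O_2^p (where the units are the respective identity operators). -/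
open scoped ENNReal

set_option linter.unusedSectionVars false

def Near (L j k : ℕ) : Prop := ∃ m ≤ L, ∃ n ≤ L, j / 2 ^ m = k / 2 ^ n

theorem Near.symm {L j k : ℕ} (h : Near L j k) : Near L k j := by
  obtain ⟨m, hm, n, hn, e⟩ := h
  exact ⟨n, hn, m, hm, e.symm⟩

theorem Near.trans {L L' i j k : ℕ} (h : Near L i j) (h' : Near L' j k) : Near (L + L') i k := by
  obtain ⟨m, hm, n, hn, e⟩ := h
  obtain ⟨m', hm', n', hn', e'⟩ := h'
  refine ⟨m + m', by omega, n' + n, by omega, ?_⟩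
  rw [pow_add, pow_add, ← Nat.div_div_eq_div_mul, ← Nat.div_div_eq_div_mul, e, ← e',
    Nat.div_div_eq_div_mul, Nat.div_div_eq_div_mul, mul_comm]

theorem Near.mono {L L' j k : ℕ} (h : Near L j k) (hL : L ≤ L') : Near L' j k := by
  obtain ⟨m, hm, n, hn, e⟩ := h
  exact ⟨m, hm.trans hL, n, hn.trans hL, e⟩

def Ds (v : ℕ) : Set ℕ := {k | ∃ n, k / 2 ^ n = v}

def Bl (L v : ℕ) : Finset ℕ :=
  (Finset.range (L + 1)).biUnion fun i => Finset.Ico (2 ^ i * v) (2 ^ i * (v + 1))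

theorem card_Bl (L v : ℕ) : (Bl L v).card ≤ (L + 1) * 2 ^ L := by
  refine (Finset.card_biUnion_le_card_mul _ _ (2 ^ L) ?_).trans (by simp)
  intro i hi
  simp only [Finset.mem_range] at hi
  rw [Nat.card_Ico, mul_add, Nat.add_sub_cancel_left, mul_one]
  exact Nat.pow_le_pow_right (by norm_num) (by omega)

theorem mem_Bl {L v i j : ℕ} (hi : i ≤ L) (h : j / 2 ^ i = v) : j ∈ Bl L v := by
  simp only [Bl, Finset.mem_biUnion, Finset.mem_range, Finset.mem_Ico]
  refine ⟨i, by omega, ?_, ?_⟩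
  · rw [← h]; exact Nat.mul_div_le j _
  · rw [← h]; exact Nat.lt_mul_div_succ j (by positivity)

theorem cross {L v j k : ℕ} (h : Near L j k) (hj : j ∈ Ds v) (hk : k ∉ Ds v) : j ∈ Bl L v := by
  obtain ⟨m, hm, n, hn, e⟩ := h
  obtain ⟨i, hi⟩ := hj
  by_cases him : i ≤ m
  · exact mem_Bl (him.trans hm) hi
  · exfalso
    apply hk
    refine ⟨n + (i - m), ?_⟩
    rw [pow_add, ← Nat.div_div_eq_div_mul, ← e, Nat.div_div_eq_div_mul, ← pow_add]
    rw [← hi]; congr 2; omega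

/-- a predicate on ℕ which is not constant has a jump -/
theorem jump (P : ℕ → Prop) {a b : ℕ} (ha : P a) (hb : ¬ P b) :
    ∃ c, P c ∧ (¬ P (c + 1) ∨ (∃ d, c = d + 1 ∧ ¬ P d)) := by
  by_contra hcon
  push Not at hcon
  have up : ∀ n, P (a + n) := by
    intro n
    induction n with
    | zero => exact ha
    | succ n ih => exact (hcon _ ih).1
  have down : ∀ n ≤ a, P (a - n) := by
    intro n
    induction n with
    | zero => intro _; exact ha
    | succ n ih => intro h; exact (hcon _ (ih (by omega))).2 _ (by omega)
  rcases le_total a b with h | h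
  · apply hb; have := up (b - a); rwa [Nat.add_sub_cancel' h] at this
  · apply hb; have := down (a - b) (by omega); rwa [Nat.sub_sub_self h] at this

theorem grid_dichotomy (A : Set (ℕ × ℕ)) (B : Finset (ℕ × ℕ))
    (h1 : ∀ a b, (a, b) ∈ A → (a + 1, b) ∉ A → (a, b) ∈ B)
    (h2 : ∀ a b, (a + 1, b) ∈ A → (a, b) ∉ A → (a + 1, b) ∈ B)
    (h3 : ∀ a b, (a, b) ∈ A → (a, b + 1) ∉ A → (a, b) ∈ B)
    (h4 : ∀ a b, (a, b + 1) ∈ A → (a, b) ∉ A → (a, b + 1) ∈ B) :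
    (Aᶜ ⊆ ((B.image Prod.fst ×ˢ B.image Prod.snd : Finset (ℕ × ℕ)) : Set (ℕ × ℕ))) ∨
    (A ⊆ ((B.image Prod.fst ×ˢ B.image Prod.snd : Finset (ℕ × ℕ)) : Set (ℕ × ℕ))) := by
  have col : ∀ a, a ∉ B.image Prod.fst → ∀ b b', (a, b) ∈ A → (a, b') ∈ A := by
    intro a ha b b' hb
    by_contra hb'
    obtain ⟨c, hc, hc'⟩ := jump (fun b => (a, b) ∈ A) hb hb'
    apply ha
    rw [Finset.mem_image]
    rcases hc' with h | ⟨d, rfl, h⟩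
    · exact ⟨_, h3 _ _ hc h, rfl⟩
    · exact ⟨_, h4 _ _ hc h, rfl⟩
  have row : ∀ b, b ∉ B.image Prod.snd → ∀ a a', (a, b) ∈ A → (a', b) ∈ A := by
    intro b ha a a' hb
    by_contra hb'
    obtain ⟨c, hc, hc'⟩ := jump (fun a => (a, b) ∈ A) hb hb'
    apply ha
    rw [Finset.mem_image]
    rcases hc' with h | ⟨d, rfl, h⟩
    · exact ⟨_, h1 _ _ hc h, rfl⟩
    · exact ⟨_, h2 _ _ hc h, rfl⟩
  obtain ⟨a₀, ha₀⟩ := Infinite.exists_notMem_finset (B.image Prod.fst)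
  obtain ⟨b₀, hb₀⟩ := Infinite.exists_notMem_finset (B.image Prod.snd)
  have key : ∀ a b, (a ∉ B.image Prod.fst ∨ b ∉ B.image Prod.snd) →
      ((a, b) ∈ A ↔ (a₀, b₀) ∈ A) := by
    intro a b h
    rcases h with h | h
    · exact ⟨fun h' => row b₀ hb₀ _ _ (col a h _ _ h'), fun h' => col a h _ _ (row b₀ hb₀ _ _ h')⟩
    · exact ⟨fun h' => col a₀ ha₀ _ _ (row b h _ _ h'), fun h' => row b h _ _ (col a₀ ha₀ _ _ h')⟩
  by_cases h0 : (a₀, b₀) ∈ A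
  · left
    rintro ⟨a, b⟩ hab
    by_contra hcon
    simp only [Finset.mem_coe, Finset.mem_product, not_and_or] at hcon
    exact hab ((key a b hcon).2 h0)
  · right
    rintro ⟨a, b⟩ hab
    by_contra hcon
    simp only [Finset.mem_coe, Finset.mem_product, not_and_or] at hcon
    exact h0 ((key a b hcon).1 hab)

theorem no_grid (F : ℕ × ℕ → ℕ) (hF : Function.Injective F) (L : ℕ)
    (hx : ∀ a b, Near L (F (a, b)) (F (a + 1, b)))
    (hy : ∀ a b, Near L (F (a, b)) (F (a, b + 1))) : False := by
  classical
  set C := (L + 1) * 2 ^ L with hC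
  obtain ⟨G, hG⟩ := Infinite.exists_subset_card_eq (ℕ × ℕ) (C * C + 1)
  obtain ⟨n, hn⟩ : ∃ n, ∀ g ∈ G, F g < 2 ^ n := by
    refine ⟨G.sup F, fun g hg => lt_of_le_of_lt (Finset.le_sup hg) Nat.lt_two_pow_self⟩
  have fin : ∀ v, 2 ^ n ≤ v → (F ⁻¹' Ds v).Finite := by
    intro v hv
    have hB := (Bl L v).card_preimage F hF.injOn
    set B := (Bl L v).preimage F hF.injOn with hBdef
    have hBc : B.card ≤ C := by
      refine le_trans ?_ (card_Bl L v)
      rw [hB]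
      exact Finset.card_filter_le _ _
    rcases grid_dichotomy (F ⁻¹' Ds v) B
      (fun a b h h' => Finset.mem_preimage.2 (cross (hx a b) h h'))
      (fun a b h h' => Finset.mem_preimage.2 (cross (hx a b).symm h h'))
      (fun a b h h' => Finset.mem_preimage.2 (cross (hy a b) h h'))
      (fun a b h h' => Finset.mem_preimage.2 (cross (hy a b).symm h h')) with h | h
    · exfalso
      have hsub : G ⊆ B.image Prod.fst ×ˢ B.image Prod.snd := by
        intro g hg
        apply Finset.mem_coe.1 (h _)
        rintro ⟨m, hm⟩
        have := hn g hg
        have h2 := Nat.div_le_self (F g) (2 ^ m)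
        omega
      have h1 := Finset.card_le_card hsub
      rw [hG, Finset.card_product] at h1
      have h2 := Nat.mul_le_mul ((Finset.card_image_le (f := Prod.fst) (s := B)).trans hBc)
        ((Finset.card_image_le (f := Prod.snd) (s := B)).trans hBc)
      omega
    · exact (Finset.finite_toSet _).subset h
  have huniv : (Set.univ : Set (ℕ × ℕ)) ⊆ (F ⁻¹' (Set.Iio (2 ^ n))) ∪
      ⋃ v ∈ Set.Ico (2 ^ n) (2 ^ (n + 1)), F ⁻¹' Ds v := by
    intro g _
    by_cases hg : F g < 2 ^ n
    · left; exact hg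
    · right
      push Not at hg
      have hne : F g ≠ 0 := by have := Nat.two_pow_pos n; omega
      have hlog : n ≤ Nat.log 2 (F g) := (Nat.le_log_iff_pow_le (by norm_num) hne).2 hg
      have hl1 := Nat.pow_log_le_self 2 hne
      have hl2 := Nat.lt_pow_succ_log_self (b := 2) (by norm_num) (F g)
      simp only [Set.mem_iUnion]
      refine ⟨F g / 2 ^ (Nat.log 2 (F g) - n), ⟨?_, ?_⟩, ⟨_, rfl⟩⟩
      · rw [Nat.le_div_iff_mul_le (by positivity), ← pow_add]
        rwa [Nat.add_sub_cancel' hlog]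
      · rw [Nat.div_lt_iff_lt_mul (by positivity), ← pow_add]
        convert hl2 using 2; omega
  refine Set.infinite_univ (Set.Finite.subset (Set.Finite.union ?_ ?_) huniv)
  · exact (Set.finite_Iio _).preimage hF.injOn
  · exact (Set.finite_Ico _ _).biUnion fun v hv => fin v hv.1

theorem rpow_add_lt_aux {x y q : ℝ} (hx : 0 < x) (hy : 0 < y) (hq : q < 1) :
    (x + y) ^ q < x ^ q + y ^ q := by
  have e : ∀ z : ℝ, 0 < z → z ^ q = z * z ^ (q - 1) := by
    intro z hz
    rw [Real.rpow_sub_one hz.ne']; field_simp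
  rw [e _ (add_pos hx hy), e _ hx, e _ hy, add_mul]
  have h1 := (Real.rpow_lt_rpow_iff_of_neg (z := q - 1) (add_pos hx hy) hx (by linarith)).2
    (by linarith)
  have h2 := (Real.rpow_lt_rpow_iff_of_neg (z := q - 1) (add_pos hx hy) hy (by linarith)).2
    (by linarith)
  have := mul_lt_mul_of_pos_left h1 hx
  have := mul_lt_mul_of_pos_left h2 hy
  linarith

theorem lt_rpow_add_aux {x y q : ℝ} (hx : 0 < x) (hy : 0 < y) (hq : 1 < q) :
    x ^ q + y ^ q < (x + y) ^ q := by
  have e : ∀ z : ℝ, 0 < z → z ^ q = z * z ^ (q - 1) := by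
    intro z hz
    rw [Real.rpow_sub_one hz.ne']; field_simp
  rw [e _ (add_pos hx hy), e _ hx, e _ hy, add_mul]
  have h1 := Real.rpow_lt_rpow (z := q - 1) hx.le (show x < x + y by linarith) (by linarith)
  have h2 := Real.rpow_lt_rpow (z := q - 1) hy.le (show y < x + y by linarith) (by linarith)
  have := mul_lt_mul_of_pos_left h1 hx
  have := mul_lt_mul_of_pos_left h2 hy
  linarith

theorem sq_rpow_half {x P : ℝ} (hx : 0 ≤ x) : (x ^ 2) ^ (P / 2) = x ^ P := by
  rw [← Real.rpow_natCast, ← Real.rpow_mul hx]; congr 1; push_cast; ring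

theorem par_sq (a b : ℂ) : ‖a + b‖ ^ 2 + ‖a - b‖ ^ 2 = 2 * (‖a‖ ^ 2 + ‖b‖ ^ 2) := by
  have := parallelogram_law_with_norm ℝ a b
  linarith [this]

theorem scal_lt_two {P : ℝ} (hP : 0 < P) (h2 : P < 2) (a b : ℂ) :
    ‖a + b‖ ^ P + ‖a - b‖ ^ P ≤ 2 * (‖a‖ ^ P + ‖b‖ ^ P) ∧
    (a ≠ 0 → b ≠ 0 → ‖a + b‖ ^ P + ‖a - b‖ ^ P < 2 * (‖a‖ ^ P + ‖b‖ ^ P)) := by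
  have strict : a ≠ 0 → b ≠ 0 → ‖a + b‖ ^ P + ‖a - b‖ ^ P < 2 * (‖a‖ ^ P + ‖b‖ ^ P) := by
    intro ha hb
    have ha' : 0 < ‖a‖ ^ 2 := by positivity
    have hb' : 0 < ‖b‖ ^ 2 := by positivity
    have h1 := rpow_add_lt_aux ha' hb' (q := P / 2) (by linarith)
    have h3 := (Real.concaveOn_rpow (p := P / 2) (by linarith) (by linarith)).2
      (show ‖a + b‖ ^ 2 ∈ Set.Ici (0 : ℝ) by simp) (show ‖a - b‖ ^ 2 ∈ Set.Ici (0 : ℝ) by simp)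
      (show (0 : ℝ) ≤ 1 / 2 by norm_num) (show (0 : ℝ) ≤ 1 / 2 by norm_num) (by norm_num)
    simp only [smul_eq_mul] at h3
    rw [← mul_add, ← mul_add, par_sq, sq_rpow_half (norm_nonneg _), sq_rpow_half (norm_nonneg _),
      ← mul_assoc, show (1 / 2 * 2 : ℝ) = 1 by norm_num, one_mul] at h3
    rw [sq_rpow_half (norm_nonneg _), sq_rpow_half (norm_nonneg _)] at h1
    linarith
  refine ⟨?_, strict⟩
  by_cases ha : a = 0
  · subst ha; simp [Real.zero_rpow hP.ne']; linarith
  by_cases hb : b = 0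
  · subst hb; simp [Real.zero_rpow hP.ne']; linarith
  exact (strict ha hb).le

theorem scal_gt_two {P : ℝ} (h2 : 2 < P) (a b : ℂ) :
    2 * (‖a‖ ^ P + ‖b‖ ^ P) ≤ ‖a + b‖ ^ P + ‖a - b‖ ^ P ∧
    (a ≠ 0 → b ≠ 0 → 2 * (‖a‖ ^ P + ‖b‖ ^ P) < ‖a + b‖ ^ P + ‖a - b‖ ^ P) := by
  have hP : 0 < P := by linarith
  have strict : a ≠ 0 → b ≠ 0 → 2 * (‖a‖ ^ P + ‖b‖ ^ P) < ‖a + b‖ ^ P + ‖a - b‖ ^ P := by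
    intro ha hb
    have ha' : 0 < ‖a‖ ^ 2 := by positivity
    have hb' : 0 < ‖b‖ ^ 2 := by positivity
    have h1 := lt_rpow_add_aux ha' hb' (q := P / 2) (by linarith)
    have h3 := (convexOn_rpow (p := P / 2) (by linarith)).2
      (show ‖a + b‖ ^ 2 ∈ Set.Ici (0 : ℝ) by simp) (show ‖a - b‖ ^ 2 ∈ Set.Ici (0 : ℝ) by simp)
      (show (0 : ℝ) ≤ 1 / 2 by norm_num) (show (0 : ℝ) ≤ 1 / 2 by norm_num) (by norm_num)
    simp only [smul_eq_mul] at h3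
    rw [← mul_add, ← mul_add, par_sq, sq_rpow_half (norm_nonneg _), sq_rpow_half (norm_nonneg _),
      ← mul_assoc, show (1 / 2 * 2 : ℝ) = 1 by norm_num, one_mul] at h3
    rw [sq_rpow_half (norm_nonneg _), sq_rpow_half (norm_nonneg _)] at h1
    linarith
  refine ⟨?_, strict⟩
  by_cases ha : a = 0
  · subst ha; simp [Real.zero_rpow hP.ne']; linarith
  by_cases hb : b = 0
  · subst hb; simp [Real.zero_rpow hP.ne']; linarith
  exact (strict ha hb).le

section lpfacts
variable {ι : Type*} {p : ℝ≥0∞} [Fact (1 ≤ p)]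

theorem toReal_pos_aux (hp : p ≠ ∞) : 0 < p.toReal :=
  ENNReal.toReal_pos (zero_lt_one.trans_le Fact.out).ne' hp

/-- the `p`-parallelogram identity -/
def Par (x y : lp (fun _ : ι => ℂ) p) : Prop :=
  ‖x + y‖ ^ p.toReal + ‖x - y‖ ^ p.toReal = 2 * (‖x‖ ^ p.toReal + ‖y‖ ^ p.toReal)

theorem par_of_disjoint (hp : p ≠ ∞) (x y : lp (fun _ : ι => ℂ) p)
    (h : ∀ j, x j = 0 ∨ y j = 0) : Par x y := by
  have h0 := toReal_pos_aux hp
  have s1 := (lp.hasSum_norm h0 (x + y)).add (lp.hasSum_norm h0 (x - y))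
  have s2 := ((lp.hasSum_norm h0 x).add (lp.hasSum_norm h0 y)).mul_left 2
  refine s1.unique ?_
  have e : (fun j => ‖(x + y) j‖ ^ p.toReal + ‖(x - y) j‖ ^ p.toReal) =
      fun j => 2 * (‖x j‖ ^ p.toReal + ‖y j‖ ^ p.toReal) := by
    funext j
    rcases h j with h | h <;> simp [h, Real.zero_rpow h0.ne'] <;> ring
  rw [e]
  exact s2

theorem disjoint_of_par (hp : p ≠ ∞) (hp2 : p ≠ 2) (x y : lp (fun _ : ι => ℂ) p)
    (h : Par x y) : ∀ j, x j = 0 ∨ y j = 0 := by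
  have h0 := toReal_pos_aux hp
  have s1 := (lp.hasSum_norm h0 (x + y)).add (lp.hasSum_norm h0 (x - y))
  have s2 := ((lp.hasSum_norm h0 x).add (lp.hasSum_norm h0 y)).mul_left 2
  have hne : p.toReal ≠ 2 := by
    intro h'
    apply hp2
    rw [← ENNReal.ofReal_toReal hp, h']; norm_num
  intro j
  by_contra hcon
  push Not at hcon
  rcases lt_or_gt_of_ne hne with hlt | hgt
  · refine absurd h (ne_of_lt (hasSum_lt (i := j) ?_ ?_ s1 s2))
    · intro i; exact (scal_lt_two h0 hlt (x i) (y i)).1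
    · exact (scal_lt_two h0 hlt (x j) (y j)).2 hcon.1 hcon.2
  · refine absurd h.symm (ne_of_lt (hasSum_lt (i := j) ?_ ?_ s2 s1))
    · intro i; exact (scal_gt_two hgt (x i) (y i)).1
    · exact (scal_gt_two hgt (x j) (y j)).2 hcon.1 hcon.2

variable [DecidableEq ι]

theorem par_single (hp : p ≠ ∞) {k l : ι} (hkl : k ≠ l) :
    Par (lp.single p k (1 : ℂ) : lp (fun _ : ι => ℂ) p) (lp.single p l 1) := by
  apply par_of_disjoint hp
  intro j
  by_cases h : j = k
  · right; subst h; exact lp.single_apply_ne p l _ hkl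
  · left; exact lp.single_apply_ne p k _ h

theorem hasSum_basis (hp : p ≠ ∞) (x : lp (fun _ : ι => ℂ) p) :
    HasSum (fun k => x k • (lp.single p k 1 : lp (fun _ : ι => ℂ) p)) x := by
  convert lp.hasSum_single hp x using 2 with k
  rw [← lp.single_smul]; simp

theorem hasSum_coord (hp : p ≠ ∞)
    (A : lp (fun _ : ι => ℂ) p →L[ℂ] lp (fun _ : ι => ℂ) p)
    (x : lp (fun _ : ι => ℂ) p) (j : ι) :
    HasSum (fun k => x k * (A (lp.single p k 1)) j) ((A x) j) := by
  have := ((hasSum_basis hp x).mapL A).mapL (lp.evalCLM ℂ (fun _ : ι => ℂ) p j)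
  simp only [map_smul, smul_eq_mul] at this
  exact this

theorem op_ext (hp : p ≠ ∞)
    {A B : lp (fun _ : ι => ℂ) p →L[ℂ] lp (fun _ : ι => ℂ) p}
    (h : ∀ k, A (lp.single p k 1) = B (lp.single p k 1)) : A = B := by
  ext x j
  have h1 := hasSum_coord hp A x j
  simp only [h] at h1
  exact h1.unique (hasSum_coord hp B x j)

theorem op_coord (hp : p ≠ ∞)
    (A : lp (fun _ : ι => ℂ) p →L[ℂ] lp (fun _ : ι => ℂ) p) (j h : ι) (w : ℂ)
    (hA : ∀ k, (A (lp.single p k 1)) j = if k = h then w else 0)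
    (x : lp (fun _ : ι => ℂ) p) : (A x) j = w * x h := by
  have h1 := hasSum_coord hp A x j
  simp only [hA] at h1
  refine h1.unique ?_
  convert hasSum_single h ?_ using 1
  · simp [mul_comm]
  · intro k hk; simp [hk]

theorem op_norm_le (hp : p ≠ ∞)
    (A : lp (fun _ : ι => ℂ) p →L[ℂ] lp (fun _ : ι => ℂ) p) (h : ι → ι) (w : ι → ℂ)
    (hw : ∀ j, ‖w j‖ ≤ 1) (hinj : ∀ j j', w j ≠ 0 → w j' ≠ 0 → h j = h j' → j = j')
    (hA : ∀ x j, (A x) j = w j * x (h j)) : ‖A‖ ≤ 1 := by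
  have h0 := toReal_pos_aux hp
  refine A.opNorm_le_bound zero_le_one fun x => ?_
  rw [one_mul]
  refine lp.norm_le_of_forall_sum_le h0 (norm_nonneg _) fun s => ?_
  have h1 : ∑ j ∈ s, ‖(A x) j‖ ^ p.toReal =
      ∑ j ∈ s with w j ≠ 0, ‖(A x) j‖ ^ p.toReal := by
    rw [Finset.sum_filter]
    refine Finset.sum_congr rfl fun j _ => ?_
    split_ifs with hj
    · rfl
    · push Not at hj
      rw [hA, hj]; simp [Real.zero_rpow h0.ne']
  rw [h1]
  calc ∑ j ∈ s with w j ≠ 0, ‖(A x) j‖ ^ p.toReal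
      ≤ ∑ j ∈ s with w j ≠ 0, ‖x (h j)‖ ^ p.toReal := by
        refine Finset.sum_le_sum fun j _ => ?_
        refine Real.rpow_le_rpow (norm_nonneg _) ?_ h0.le
        rw [hA, norm_mul]
        exact mul_le_of_le_one_left (norm_nonneg _) (hw j)
    _ = ∑ i ∈ (s.filter fun j => w j ≠ 0).image h, ‖x i‖ ^ p.toReal := by
        rw [Finset.sum_image]
        intro a ha b hb hab
        exact hinj a b (by simpa using (Finset.mem_filter.1 ha).2)
          (by simpa using (Finset.mem_filter.1 hb).2) hab
    _ ≤ ‖x‖ ^ p.toReal := lp.sum_rpow_le_norm_rpow h0 x _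

/-- the pair (S,T) implements the injection g on the canonical basis -/
structure Impl (S T : lp (fun _ : ι => ℂ) p →L[ℂ] lp (fun _ : ι => ℂ) p) (g : ι → ι) : Prop where
  inj : Function.Injective g
  hS : ∀ k, S (lp.single p k 1) = lp.single p (g k) 1
  hT : ∀ k, T (lp.single p (g k) 1) = lp.single p k 1
  hT0 : ∀ k, (∀ l, k ≠ g l) → T (lp.single p k 1) = 0

variable {S T : lp (fun _ : ι => ℂ) p →L[ℂ] lp (fun _ : ι => ℂ) p} {g : ι → ι}

theorem Impl.mul_eq (hp : p ≠ ∞) (h : Impl S T g) : T * S = 1 := by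
  apply op_ext hp
  intro k
  simp [h.hS, h.hT]

theorem single_ite (k j : ι) :
    (lp.single p k (1 : ℂ) : lp (fun _ : ι => ℂ) p) j = if j = k then 1 else 0 := by
  rw [lp.single_apply, Pi.single_apply]

theorem Impl.norm_T (hp : p ≠ ∞) (h : Impl S T g) : ‖T‖ ≤ 1 := by
  refine op_norm_le hp T g (fun _ => 1) (by simp) (fun j j' _ _ e => h.inj e) ?_
  intro x j
  refine op_coord hp T j _ _ ?_ x
  intro k
  by_cases hk : ∃ l, k = g l
  · obtain ⟨l, rfl⟩ := hk
    rw [h.hT, single_ite]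
    simp [h.inj.eq_iff, eq_comm]
  · push Not at hk
    rw [h.hT0 k hk, if_neg (hk j)]; rfl

open Classical in
theorem Impl.norm_S (hp : p ≠ ∞) (h : Impl S T g) : ‖S‖ ≤ 1 := by
  refine op_norm_le hp S (fun j => if hj : ∃ l, j = g l then hj.choose else j)
    (fun j => if ∃ l, j = g l then 1 else 0) ?_ ?_ ?_
  · intro j; split_ifs <;> simp
  · intro j j' hj hj' e
    have hj : ∃ l, j = g l := by by_contra h; simp [h] at hj
    have hj' : ∃ l, j' = g l := by by_contra h; simp [h] at hj'
    rw [dif_pos hj, dif_pos hj'] at e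
    rw [hj.choose_spec, hj'.choose_spec, e]
  · intro x j
    refine op_coord hp S j _ _ ?_ x
    intro k
    rw [h.hS, single_ite]
    by_cases hj : ∃ l, j = g l
    · rw [dif_pos hj, if_pos hj]
      have := hj.choose_spec
      by_cases hk : k = hj.choose
      · rw [if_pos hk, if_pos]; rw [hk, ← this]
      · rw [if_neg hk, if_neg]
        intro h'; apply hk; apply h.inj; rw [← this, h']
    · rw [if_neg hj, if_neg]
      · simp
      · intro h'; exact hj ⟨k, h'⟩

open Classical in
theorem Impl.norm_U (hp : p ≠ ∞) (h : Impl S T g) (z : ℂ) (hz : ‖z‖ = 1) :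
    ‖(1 - (1 - z) • (S * T) : lp (fun _ : ι => ℂ) p →L[ℂ] lp (fun _ : ι => ℂ) p)‖ ≤ 1 := by
  refine op_norm_le hp _ id (fun j => if ∃ l, j = g l then z else 1) ?_ (fun _ _ _ _ e => e) ?_
  · intro j; split_ifs <;> simp [hz]
  · intro x j
    refine op_coord hp _ j _ _ ?_ x
    intro k
    have e1 : (1 - (1 - z) • (S * T) : lp (fun _ : ι => ℂ) p →L[ℂ] lp (fun _ : ι => ℂ) p)
        (lp.single p k 1) = (if ∃ l, k = g l then z else 1) • lp.single p k 1 := by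
      by_cases hk : ∃ l, k = g l
      · rw [if_pos hk]
        obtain ⟨l, rfl⟩ := hk
        simp [h.hT, h.hS, sub_smul]
      · rw [if_neg hk]
        push Not at hk
        simp [h.hT0 k hk]
    rw [e1, lp.coeFn_smul, Pi.smul_apply, single_ite]
    by_cases hkj : k = j
    · subst hkj; simp
    · simp [hkj, Ne.symm hkj]

end lpfacts

section spatial
variable {ι : Type*} {p : ℝ≥0∞} [Fact (1 ≤ p)] [DecidableEq ι]

theorem single_norm_one (k : ι) : ‖(lp.single p k (1 : ℂ) : lp (fun _ : ι => ℂ) p)‖ = 1 := by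
  rw [lp.norm_single (zero_lt_one.trans_le Fact.out)]; simp

theorem contr_apply {A : lp (fun _ : ι => ℂ) p →L[ℂ] lp (fun _ : ι => ℂ) p} (h : ‖A‖ ≤ 1)
    (x : lp (fun _ : ι => ℂ) p) : ‖A x‖ ≤ ‖x‖ := by
  simpa using A.le_of_opNorm_le h x

theorem exists_single (hp : p ≠ ∞) (hp2 : p ≠ 2)
    {s t : lp (fun _ : ι => ℂ) p →L[ℂ] lp (fun _ : ι => ℂ) p}
    (hs : ‖s‖ ≤ 1) (ht : ‖t‖ ≤ 1) (hts : t * s = 1) (k : ι)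
    (hfix : ∀ j, (s (lp.single p k 1)) j ≠ 0 → s (t (lp.single p j 1)) = lp.single p j 1) :
    ∃ j, ∃ c : ℂ, ‖c‖ = 1 ∧ s (lp.single p k 1) = c • lp.single p j 1 := by
  have hts' : ∀ x, t (s x) = x := fun x => by
    have := congrArg (fun A => A x) hts
    simpa using this
  have iso : ∀ y, s (t y) = y → ‖t y‖ = ‖y‖ := by
    intro y hy
    refine le_antisymm (contr_apply ht y) ?_
    calc ‖y‖ = ‖s (t y)‖ := by rw [hy]
      _ ≤ ‖t y‖ := contr_apply hs _
  have isos : ∀ y, ‖s y‖ = ‖y‖ := by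
    intro y
    refine le_antisymm (contr_apply hs y) ?_
    calc ‖y‖ = ‖t (s y)‖ := by rw [hts']
      _ ≤ ‖s y‖ := contr_apply ht _
  set x := s (lp.single p k 1) with hx
  have dis : ∀ j j', x j ≠ 0 → x j' ≠ 0 → j ≠ j' →
      ∀ m, (t (lp.single p j 1)) m = 0 ∨ (t (lp.single p j' 1)) m = 0 := by
    intro j j' hj hj' hne
    apply disjoint_of_par hp hp2
    have := par_single (p := p) hp hne
    unfold Par at this ⊢
    rw [← map_add, ← map_sub, iso _ (hfix j hj), iso _ (hfix j' hj'), iso, iso, this]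
    · rw [map_sub, map_sub, hfix j hj, hfix j' hj']
    · rw [map_add, map_add, hfix j hj, hfix j' hj']
  have hk : ∀ j, x j ≠ 0 → (t (lp.single p j 1)) k ≠ 0 := by
    intro j hj
    have hne : t (lp.single p j 1) ≠ 0 := by
      intro h0
      have := iso _ (hfix j hj)
      rw [h0, single_norm_one] at this
      simp at this
    obtain ⟨m, hm⟩ : ∃ m, (t (lp.single p j 1)) m ≠ 0 := by
      by_contra hcon
      push Not at hcon
      apply hne
      ext m
      exact hcon m
    have h1 := hasSum_coord hp t x m
    have h2 : HasSum (fun i => x i * (t (lp.single p i 1)) m) (x j * (t (lp.single p j 1)) m) := by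
      apply hasSum_single
      intro i hi
      by_cases hxi : x i = 0
      · simp [hxi]
      · rcases dis i j hxi hj hi m with h | h
        · simp [h]
        · exact absurd h hm
    have h3 := h1.unique h2
    rw [hx, hts', single_ite] at h3
    by_cases hmk : m = k
    · rwa [hmk] at hm
    · rw [if_neg hmk, ← hx] at h3
      exact absurd h3.symm (mul_ne_zero hj hm)
  have hxn : ‖x‖ = 1 := by rw [hx, isos, single_norm_one]
  obtain ⟨j, hj⟩ : ∃ j, x j ≠ 0 := by
    by_contra hcon
    push Not at hcon
    have : x = 0 := by ext m; exact hcon m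
    rw [this] at hxn; simp at hxn
  have hxj : x = x j • lp.single p j 1 := by
    ext m
    rw [lp.coeFn_smul, Pi.smul_apply, single_ite]
    by_cases hmj : m = j
    · simp [hmj]
    · simp only [hmj, if_false, smul_zero]
      by_contra hm
      rcases dis m j hm hj hmj k with h | h
      · exact hk m hm h
      · exact hk j hj h
  refine ⟨j, x j, ?_, hxj⟩
  rw [hxj, norm_smul, single_norm_one, mul_one] at hxn
  exact hxn

/-- abstract spatial isometry with reverse -/
structure Good (s t : lp (fun _ : ι => ℂ) p →L[ℂ] lp (fun _ : ι => ℂ) p) : Prop where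
  hs : ‖s‖ ≤ 1
  ht : ‖t‖ ≤ 1
  hts : t * s = 1
  hU : ∀ z : ℂ, ‖z‖ = 1 → ‖1 - (1 - z) • (s * t)‖ ≤ 1

theorem Good.spatial (hp : p ≠ ∞) (hp2 : p ≠ 2)
    {s t : lp (fun _ : ι => ℂ) p →L[ℂ] lp (fun _ : ι => ℂ) p} (h : Good s t) (k : ι) :
    ∃ j, ∃ c : ℂ, ‖c‖ = 1 ∧ s (lp.single p k 1) = c • lp.single p j 1 := by
  set e := s * t with he
  have hee : e * e = e := by
    rw [he, mul_assoc, ← mul_assoc t, h.hts, one_mul]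
  have comp : ∀ a b : ℂ, (1 - a • e) * (1 - b • e) = 1 - (a + b - a * b) • e := by
    intro a b
    simp only [mul_sub, sub_mul, one_mul, mul_one, smul_mul_smul_comm, hee, sub_smul, add_smul]
    abel
  have gen : ∀ z : ℂ, ‖z‖ = 1 → ∀ k, ∃ j, ∃ c : ℂ, ‖c‖ = 1 ∧
      (1 - (1 - z) • e) (lp.single p k 1) = c • lp.single p j 1 := by
    intro z hz k
    have hz0 : z ≠ 0 := by intro h0; simp [h0] at hz
    have e1 : (1 - (1 - z⁻¹) • e) * (1 - (1 - z) • e) = 1 := by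
      rw [comp, show (1 - z⁻¹) + (1 - z) - (1 - z⁻¹) * (1 - z) = 0 by field_simp; ring]; simp
    have e2 : (1 - (1 - z) • e) * (1 - (1 - z⁻¹) • e) = 1 := by
      rw [comp, show (1 - z) + (1 - z⁻¹) - (1 - z) * (1 - z⁻¹) = 0 by field_simp; ring]; simp
    refine exists_single hp hp2 (h.hU z hz) (h.hU z⁻¹ (by simp [hz])) e1 k ?_
    intro j _
    have := congrArg (fun A => A (lp.single p j 1)) e2
    exact this
  have diag : ∀ k, ∃ w : ℂ, e (lp.single p k 1) = w • lp.single p k 1 := by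
    intro k
    obtain ⟨j, c, hc, h1⟩ := gen Complex.I (by simp) k
    obtain ⟨l, d, hd, h2⟩ := gen (-1) (by simp) k
    have h1' : ∀ m, (if m = k then (1 : ℂ) else 0) - (1 - Complex.I) * (e (lp.single p k 1)) m =
        c * (if m = j then (1 : ℂ) else 0) := by
      intro m
      have := congrArg (fun x : lp (fun _ : ι => ℂ) p => x m) h1
      rw [← single_ite (p := p), ← single_ite (p := p)]
      exact this
    have h2' : ∀ m, (if m = k then (1 : ℂ) else 0) - (1 - (-1)) * (e (lp.single p k 1)) m =
        d * (if m = l then (1 : ℂ) else 0) := by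
      intro m
      have := congrArg (fun x : lp (fun _ : ι => ℂ) p => x m) h2
      rw [← single_ite (p := p), ← single_ite (p := p)]
      exact this
    have hI : (1 - Complex.I) ≠ 0 := by
      intro h0
      have := congrArg Complex.re h0
      simp at this
    have hc0 : c ≠ 0 := by intro h0; simp [h0] at hc
    have hoff : ∀ m, m ≠ k → (e (lp.single p k 1)) m = 0 := by
      by_cases hjk : j = k
      · intro m hm
        have := h1' m
        rw [if_neg hm, hjk, if_neg hm] at this
        simpa [hI] using this
      · exfalso
        have a1 := h1' k
        rw [if_pos rfl, if_neg (Ne.symm hjk), mul_zero] at a1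
        have a2 := h2' k
        rw [if_pos rfl] at a2
        by_cases hlk : l = k
        · have a3 := h2' j
          have a4 := h1' j
          rw [if_neg hjk, hlk, if_neg hjk] at a3
          rw [if_neg hjk, if_pos rfl] at a4
          have a5 : (e (lp.single p k 1)) j = 0 := by
            linear_combination (-1/2) * a3
          rw [a5] at a4
          apply hc0; linear_combination -a4
        · rw [if_neg (Ne.symm hlk), mul_zero] at a2
          have a5 : (e (lp.single p k 1)) k = 1 / 2 := by linear_combination (-1/2) * a2
          rw [a5] at a1
          have := congrArg Complex.im a1
          simp at this
    refine ⟨(e (lp.single p k 1)) k, ?_⟩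
    ext m
    rw [lp.coeFn_smul, Pi.smul_apply, single_ite]
    by_cases hm : m = k
    · simp [hm]
    · simp [hm, hoff m hm]
  choose w hw using diag
  refine exists_single hp hp2 h.hs h.ht h.hts k ?_
  intro j hj
  have c1 : (e (s (lp.single p k 1))) j = w j * (s (lp.single p k 1)) j := by
    apply op_coord hp
    intro i
    rw [hw, lp.coeFn_smul, Pi.smul_apply, single_ite]
    by_cases hij : i = j
    · simp [hij]
    · simp [hij, Ne.symm hij]
  have c2 : e (s (lp.single p k 1)) = s (lp.single p k 1) := by
    have : e * s = s := by rw [he, mul_assoc, h.hts, mul_one]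
    exact congrArg (fun A => A (lp.single p k 1)) this
  rw [c2] at c1
  have c3 : w j = 1 := by
    have : (w j - 1) * (s (lp.single p k 1)) j = 0 := by linear_combination -c1
    rcases mul_eq_zero.1 this with h | h
    · linear_combination h
    · exact absurd h hj
  have := hw j
  rw [c3, one_smul] at this
  exact this

end spatial

section band
variable {p : ℝ≥0∞} [Fact (1 ≤ p)]

def Bd (A : lp (fun _ : ℕ => ℂ) p →L[ℂ] lp (fun _ : ℕ => ℂ) p) : Prop :=
  ∃ L, ∀ k j, (A (lp.single p k 1)) j ≠ 0 → Near L k j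

theorem Bd.add {A B : lp (fun _ : ℕ => ℂ) p →L[ℂ] lp (fun _ : ℕ => ℂ) p}
    (hA : Bd A) (hB : Bd B) : Bd (A + B) := by
  obtain ⟨L, hL⟩ := hA
  obtain ⟨M, hM⟩ := hB
  refine ⟨max L M, fun k j h => ?_⟩
  by_cases hA : (A (lp.single p k 1)) j = 0
  · by_cases hB : (B (lp.single p k 1)) j = 0
    · exfalso; apply h; simp [hA, hB]
    · exact (hM k j hB).mono (le_max_right _ _)
  · exact (hL k j hA).mono (le_max_left _ _)

theorem Bd.mul (hp : p ≠ ∞) {A B : lp (fun _ : ℕ => ℂ) p →L[ℂ] lp (fun _ : ℕ => ℂ) p}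
    (hA : Bd A) (hB : Bd B) : Bd (A * B) := by
  obtain ⟨L, hL⟩ := hA
  obtain ⟨M, hM⟩ := hB
  refine ⟨M + L, fun k j h => ?_⟩
  have h1 := hasSum_coord hp A (B (lp.single p k 1)) j
  by_contra hcon
  apply h
  refine h1.unique ?_
  convert hasSum_zero with i
  by_contra hne
  exact hcon ((hM k i (left_ne_zero_of_mul hne)).trans (hL i j (right_ne_zero_of_mul hne)))

theorem Bd.algebraMap (r : ℂ) :
    Bd (algebraMap ℂ (lp (fun _ : ℕ => ℂ) p →L[ℂ] lp (fun _ : ℕ => ℂ) p) r) := by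
  refine ⟨0, fun k j h => ?_⟩
  have : j = k := by
    by_contra hjk
    apply h
    rw [Algebra.algebraMap_eq_smul_one]
    have := single_ite (p := p) k j
    rw [if_neg hjk] at this
    exact mul_eq_zero_of_right r this
  exact ⟨0, le_rfl, 0, le_rfl, by rw [this]⟩

theorem band_closure (hp : p ≠ ∞)
    {G : Set (lp (fun _ : ℕ => ℂ) p →L[ℂ] lp (fun _ : ℕ => ℂ) p)} (hG : ∀ x ∈ G, Bd x)
    {A : lp (fun _ : ℕ => ℂ) p →L[ℂ] lp (fun _ : ℕ => ℂ) p}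
    (hA : A ∈ (Algebra.adjoin ℂ G).topologicalClosure) :
    ∃ L, ∀ k j, ∀ c : ℂ, ‖c‖ = 1 → A (lp.single p k 1) = c • lp.single p j 1 → Near L k j := by
  have hA' : A ∈ closure ((Algebra.adjoin ℂ G : Subalgebra ℂ _) :
    Set (lp (fun _ : ℕ => ℂ) p →L[ℂ] lp (fun _ : ℕ => ℂ) p)) := hA
  rw [Metric.mem_closure_iff] at hA'
  obtain ⟨B, hB, hd⟩ := hA' 1 one_pos
  have hBd : Bd B := by
    refine Algebra.adjoin_induction (p := fun x _ => Bd x) hG Bd.algebraMap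
      (fun x y _ _ hx hy => hx.add hy) (fun x y _ _ hx hy => hx.mul hp hy) hB
  obtain ⟨L, hL⟩ := hBd
  refine ⟨L, fun k j c hc hk => hL k j fun h0 => ?_⟩
  rw [dist_eq_norm] at hd
  have h1 : ‖((A - B) (lp.single p k 1)) j‖ ≤ ‖A - B‖ := by
    refine (lp.norm_apply_le_norm (zero_lt_one.trans_le Fact.out).ne' _ j).trans ?_
    refine ((A - B).le_opNorm _).trans ?_
    rw [single_norm_one, mul_one]
  have h2 : ((A - B) (lp.single p k 1)) j = c := by
    rw [sub_apply, lp.coeFn_sub, Pi.sub_apply, h0, hk, lp.coeFn_smul,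
      Pi.smul_apply, single_ite]
    simp
  rw [h2, hc] at h1
  linarith

theorem near_double (k : ℕ) (j : Fin 2) : Near 1 k (2 * k + (j : ℕ)) := by
  refine ⟨0, by omega, 1, le_rfl, ?_⟩
  have := j.2
  omega

theorem core (hp : p ≠ ∞) (hp2 : p ≠ 2)
    (s t u v : Fin 2 → (lp (fun _ : ℕ => ℂ) p →L[ℂ] lp (fun _ : ℕ => ℂ) p))
    (hst : ∀ i, Good (s i) (t i)) (huv : ∀ i, Good (u i) (v i))
    (ht01 : t 0 * s 1 = 0) (hv01 : v 0 * u 1 = 0)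
    (hcomm : ∀ i j, s i * u j = u j * s i)
    (hbs : ∃ L, ∀ k j, ∀ c : ℂ, ‖c‖ = 1 → s 0 (lp.single p k 1) = c • lp.single p j 1 → Near L k j)
    (hbu : ∃ L, ∀ k j, ∀ c : ℂ, ‖c‖ = 1 → u 0 (lp.single p k 1) = c • lp.single p j 1 → Near L k j) :
    False := by
  choose σ c hc hσ using fun i => (hst i).spatial hp hp2
  choose τ d hd hτ using fun i => (huv i).spatial hp hp2
  obtain ⟨L, hL⟩ := hbs
  obtain ⟨M, hM⟩ := hbu
  have ne0 : ∀ {z : ℂ}, ‖z‖ = 1 → z ≠ 0 := by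
    intro z hz h; simp [h] at hz
  have sinj : ∀ {a b : ℂ} {k l : ℕ}, a ≠ 0 →
      a • (lp.single p k 1 : lp (fun _ : ℕ => ℂ) p) = b • lp.single p l 1 → k = l := by
    intro a b k l ha h
    by_contra hkl
    have := congrArg (fun x : lp (fun _ : ℕ => ℂ) p => x k) h
    simp only [lp.coeFn_smul, Pi.smul_apply, single_ite, if_neg hkl] at this
    simp [ha] at this
  have injgen : ∀ (s t : lp (fun _ : ℕ => ℂ) p →L[ℂ] lp (fun _ : ℕ => ℂ) p) (σ : ℕ → ℕ)
      (c : ℕ → ℂ), Good s t → (∀ k, ‖c k‖ = 1) →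
      (∀ k, s (lp.single p k 1) = c k • lp.single p (σ k) 1) → Function.Injective σ := by
    intro s t σ c hg hc hσ k l hkl
    have h1 : ∀ k, (c k) • t (lp.single p (σ k) 1) = lp.single p k 1 := by
      intro k
      rw [← map_smul, ← hσ]
      exact congrArg (fun A => A (lp.single p k 1)) hg.hts
    have h2 : (c l) • (lp.single p k 1 : lp (fun _ : ℕ => ℂ) p) = (c k) • lp.single p l 1 := by
      rw [← h1 k, ← h1 l, hkl, smul_comm]
    exact sinj (ne0 (hc l)) h2
  have disgen : ∀ (s s' t : lp (fun _ : ℕ => ℂ) p →L[ℂ] lp (fun _ : ℕ => ℂ) p) (σ σ' : ℕ → ℕ)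
      (c c' : ℕ → ℂ), Good s t → t * s' = 0 → (∀ k, ‖c k‖ = 1) → (∀ k, ‖c' k‖ = 1) →
      (∀ k, s (lp.single p k 1) = c k • lp.single p (σ k) 1) →
      (∀ k, s' (lp.single p k 1) = c' k • lp.single p (σ' k) 1) → ∀ k l, σ k ≠ σ' l := by
    intro s s' t σ σ' c c' hg h0 hc hc' hσ hσ' k l hkl
    have h1 : (c k) • t (lp.single p (σ k) 1) = lp.single p k 1 := by
      rw [← map_smul, ← hσ]
      exact congrArg (fun A => A (lp.single p k 1)) hg.hts
    have h2 : (c' l) • t (lp.single p (σ' l) 1) = 0 := by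
      rw [← map_smul, ← hσ']
      exact congrArg (fun A => A (lp.single p l 1)) h0
    rw [← hkl] at h2
    rw [(smul_eq_zero.1 h2).resolve_left (ne0 (hc' l)), smul_zero] at h1
    have := single_norm_one (p := p) k
    rw [← h1] at this
    simp at this
  have σinj : ∀ i, Function.Injective (σ i) := fun i => injgen _ _ _ _ (hst i) (hc i) (hσ i)
  have τinj : ∀ i, Function.Injective (τ i) := fun i => injgen _ _ _ _ (huv i) (hd i) (hτ i)
  have σdis : ∀ k l, σ 0 k ≠ σ 1 l := disgen _ _ _ _ _ _ _ (hst 0) ht01 (hc 0) (hc 1) (hσ 0) (hσ 1)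
  have τdis : ∀ k l, τ 0 k ≠ τ 1 l := disgen _ _ _ _ _ _ _ (huv 0) hv01 (hd 0) (hd 1) (hτ 0) (hτ 1)
  have στ : ∀ i j, Function.Commute (σ i) (τ j) := by
    intro i j k
    have h1 : s i (u j (lp.single p k 1)) = u j (s i (lp.single p k 1)) :=
      congrArg (fun A => A (lp.single p k 1)) (hcomm i j)
    rw [hτ, hσ, map_smul, map_smul, hσ, hτ, smul_smul, smul_smul] at h1
    exact sinj (mul_ne_zero (ne0 (hd _ _)) (ne0 (hc _ _))) h1
  have itinj : ∀ (f g : ℕ → ℕ), Function.Injective f → (∀ k l, f k ≠ g l) →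
      ∀ a a' x y, f^[a] (g x) = f^[a'] (g y) → a = a' := by
    intro f g hf hfg a
    induction a with
    | zero =>
      intro a' x y h
      cases a' with
      | zero => rfl
      | succ n => rw [Function.iterate_succ_apply'] at h; exact absurd h.symm (hfg _ _)
    | succ n ih =>
      intro a' x y h
      cases a' with
      | zero => rw [Function.iterate_succ_apply'] at h; exact absurd h (hfg _ _)
      | succ m =>
        rw [Function.iterate_succ_apply', Function.iterate_succ_apply'] at h
        rw [ih m x y (hf h)]
  let F : ℕ × ℕ → ℕ := fun ab => (σ 0)^[ab.1] ((τ 0)^[ab.2] (σ 1 (τ 1 0)))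
  have F1 : ∀ a b, F (a, b) = (σ 0)^[a] (σ 1 ((τ 0)^[b] (τ 1 0))) := by
    intro a b
    change (σ 0)^[a] ((τ 0)^[b] (σ 1 (τ 1 0))) = _
    rw [((στ 1 0).iterate_right b).eq]
  have F2 : ∀ a b, F (a, b) = (τ 0)^[b] (τ 1 ((σ 0)^[a] (σ 1 0))) := by
    intro a b
    change (σ 0)^[a] ((τ 0)^[b] (σ 1 (τ 1 0))) = _
    rw [(((στ 0 0).iterate_right b).iterate_left a).eq, (στ 1 1).eq,
      ((στ 0 1).iterate_left a).eq]
  refine no_grid F ?_ (max L M) ?_ ?_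
  · rintro ⟨a, b⟩ ⟨a', b'⟩ h
    have h1 := h
    rw [F1, F1] at h1
    rw [F2, F2] at h
    rw [itinj _ _ (σinj 0) σdis _ _ _ _ h1, itinj _ _ (τinj 0) τdis _ _ _ _ h]
  · intro a b
    have : F (a + 1, b) = σ 0 (F (a, b)) := by
      simp only [F, Function.iterate_succ_apply']
    rw [this]
    exact (hL _ _ _ (hc 0 _) (hσ 0 _)).mono (le_max_left _ _)
  · intro a b
    have : F (a, b + 1) = τ 0 (F (a, b)) := by
      rw [F2, F2, Function.iterate_succ_apply']
    rw [this]
    exact (hM _ _ _ (hd 0 _) (hτ 0 _)).mono (le_max_right _ _)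

end band


theorem core_map {p : ℝ≥0∞} [Fact (1 ≤ p)] (hp_top : p ≠ ∞) (hp_two : p ≠ 2)
    {D : Subalgebra ℂ (lp (fun _ : ℕ × ℕ => ℂ) p →L[ℂ] lp (fun _ : ℕ × ℕ => ℂ) p)}
    {O : Subalgebra ℂ (lp (fun _ : ℕ => ℂ) p →L[ℂ] lp (fun _ : ℕ => ℂ) p)}
    (φ : D →ₐ[ℂ] O) (hφ : ∀ a, ‖φ a‖ ≤ ‖a‖)
    (SL TL SR TR : Fin 2 → (lp (fun _ : ℕ × ℕ => ℂ) p →L[ℂ] lp (fun _ : ℕ × ℕ => ℂ) p))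
    (mSL : ∀ j, SL j ∈ D) (mTL : ∀ j, TL j ∈ D) (mSR : ∀ j, SR j ∈ D) (mTR : ∀ j, TR j ∈ D)
    (gL gR : Fin 2 → ℕ × ℕ → ℕ × ℕ)
    (iL : ∀ j, Impl (SL j) (TL j) (gL j)) (iR : ∀ j, Impl (SR j) (TR j) (gR j))
    (hcomm : ∀ i j, SL i * SR j = SR j * SL i)
    (hL01 : TL 0 * SL 1 = 0) (hR01 : TR 0 * SR 1 = 0)
    (hO : ∀ A ∈ O, ∃ L, ∀ k j, ∀ c : ℂ, ‖c‖ = 1 →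
      A (lp.single p k 1) = c • lp.single p j 1 → Near L k j) : False := by
  have good : ∀ x y g (hx : x ∈ D) (hy : y ∈ D), Impl x y g →
      Good (φ ⟨x, hx⟩ : lp (fun _ : ℕ => ℂ) p →L[ℂ] lp (fun _ : ℕ => ℂ) p) (φ ⟨y, hy⟩) := by
    intro x y g hx hy hi
    refine ⟨(hφ _).trans (hi.norm_S hp_top), (hφ _).trans (hi.norm_T hp_top), ?_, ?_⟩
    · have h1 : (⟨y, hy⟩ * ⟨x, hx⟩ : D) = 1 :=
        Subtype.ext (hi.mul_eq hp_top)
      have h2 := congrArg φ h1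
      rw [map_mul, map_one] at h2
      exact congrArg Subtype.val h2
    · intro z hz
      set a : D := 1 - (1 - z) • (⟨x, hx⟩ * ⟨y, hy⟩) with ha
      have e1 : (a : lp (fun _ : ℕ × ℕ => ℂ) p →L[ℂ] lp (fun _ : ℕ × ℕ => ℂ) p) =
          1 - (1 - z) • (x * y) := by
        rw [ha]
        simp only [Subalgebra.coe_sub, Subalgebra.coe_one, Subalgebra.coe_smul, Subalgebra.coe_mul]
      have e2 : (φ a : lp (fun _ : ℕ => ℂ) p →L[ℂ] lp (fun _ : ℕ => ℂ) p) =
          1 - (1 - z) • ((φ ⟨x, hx⟩ : lp (fun _ : ℕ => ℂ) p →L[ℂ] lp (fun _ : ℕ => ℂ) p) *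
            (φ ⟨y, hy⟩ : lp (fun _ : ℕ => ℂ) p →L[ℂ] lp (fun _ : ℕ => ℂ) p)) := by
        rw [ha, map_sub, map_one, map_smul, map_mul]
        simp only [Subalgebra.coe_sub, Subalgebra.coe_one, Subalgebra.coe_smul, Subalgebra.coe_mul]
      rw [← e2]
      have h2 := hi.norm_U hp_top z hz
      rw [← e1] at h2
      exact (hφ a).trans h2
  refine core hp_top hp_two (fun j => (φ ⟨SL j, mSL j⟩ : lp (fun _ : ℕ => ℂ) p →L[ℂ] _))
    (fun j => φ ⟨TL j, mTL j⟩) (fun j => φ ⟨SR j, mSR j⟩) (fun j => φ ⟨TR j, mTR j⟩)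
    (fun i => good _ _ _ _ _ (iL i)) (fun i => good _ _ _ _ _ (iR i)) ?_ ?_ ?_
    (hO _ (φ ⟨SL 0, mSL 0⟩).2)
    (hO _ (φ ⟨SR 0, mSR 0⟩).2)
  · have h2 := congrArg φ (show (⟨TL 0, mTL 0⟩ * ⟨SL 1, mSL 1⟩ : D) = 0
        from Subtype.ext hL01)
    rw [map_mul, map_zero] at h2
    exact congrArg Subtype.val h2
  · have h2 := congrArg φ (show (⟨TR 0, mTR 0⟩ * ⟨SR 1, mSR 1⟩ : D) = 0
        from Subtype.ext hR01)
    rw [map_mul, map_zero] at h2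
    exact congrArg Subtype.val h2
  · intro i j
    have h2 := congrArg φ (show (⟨SL i, mSL i⟩ * ⟨SR j, mSR j⟩ : D) =
        ⟨SR j, mSR j⟩ * ⟨SL i, mSL i⟩ from Subtype.ext (hcomm i j))
    rw [map_mul, map_mul] at h2
    exact congrArg Subtype.val h2

/-- For `p ∈ [1,∞) \ {2}`, there is no unital contractive homomorphism from the canonical
concrete realization `D` of `O₂^p ⊗_p O₂^p` on `ℓ^p(ℕ × ℕ)` to the `L^p`-Cuntz algebra
`O₂^p ⊆ B(ℓ^p(ℕ))`.  Here `O₂^p` is the smallest closed subalgebra of `B(ℓ^p(ℕ))` containing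
the shifts `S₀, S₁, T₀, T₁` determined on the canonical basis by `S_j δ_k = δ_{2k+j}`,
`T_j δ_{2l+j} = δ_l` and `T_j δ_k = 0` if `k ≢ j (mod 2)`; and `D` is the smallest closed
subalgebra of `B(ℓ^p(ℕ × ℕ))` containing the eight operators
`S_j ⊗ 1, T_j ⊗ 1, 1 ⊗ S_j, 1 ⊗ T_j`. -/
theorem no_unital_contractive_hom_O2_tensor_O2_to_O2
    (p : ℝ≥0∞) [Fact (1 ≤ p)] (hp_top : p ≠ ∞) (hp_two : p ≠ 2)
    (S T : Fin 2 → (lp (fun _ : ℕ => ℂ) p →L[ℂ] lp (fun _ : ℕ => ℂ) p))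
    (hS : ∀ (j : Fin 2) (k : ℕ), S j (lp.single p k 1) = lp.single p (2 * k + (j : ℕ)) 1)
    (hT : ∀ (j : Fin 2) (k l : ℕ), k = 2 * l + (j : ℕ) →
      T j (lp.single p k 1) = lp.single p l 1)
    (hT₀ : ∀ (j : Fin 2) (k : ℕ), (¬ ∃ l : ℕ, k = 2 * l + (j : ℕ)) →
      T j (lp.single p k 1) = 0)
    (SL TL SR TR : Fin 2 → (lp (fun _ : ℕ × ℕ => ℂ) p →L[ℂ] lp (fun _ : ℕ × ℕ => ℂ) p))
    (hSL : ∀ (j : Fin 2) (k l : ℕ),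
      SL j (lp.single p (k, l) 1) = lp.single p (2 * k + (j : ℕ), l) 1)
    (hTL : ∀ (j : Fin 2) (k l c : ℕ), k = 2 * c + (j : ℕ) →
      TL j (lp.single p (k, l) 1) = lp.single p (c, l) 1)
    (hTL₀ : ∀ (j : Fin 2) (k l : ℕ), (¬ ∃ c : ℕ, k = 2 * c + (j : ℕ)) →
      TL j (lp.single p (k, l) 1) = 0)
    (hSR : ∀ (j : Fin 2) (k l : ℕ),
      SR j (lp.single p (k, l) 1) = lp.single p (k, 2 * l + (j : ℕ)) 1)
    (hTR : ∀ (j : Fin 2) (k l c : ℕ), l = 2 * c + (j : ℕ) →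
      TR j (lp.single p (k, l) 1) = lp.single p (k, c) 1)
    (hTR₀ : ∀ (j : Fin 2) (k l : ℕ), (¬ ∃ c : ℕ, l = 2 * c + (j : ℕ)) →
      TR j (lp.single p (k, l) 1) = 0) :
    ¬ ∃ φ : (Algebra.adjoin ℂ
        ({x | ∃ j : Fin 2, x = SL j ∨ x = TL j ∨ x = SR j ∨ x = TR j})).topologicalClosure →ₐ[ℂ]
        (Algebra.adjoin ℂ ({x | ∃ j : Fin 2, x = S j ∨ x = T j})).topologicalClosure,
      ∀ a, ‖φ a‖ ≤ ‖a‖ := by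
  rintro ⟨φ, hφ⟩
  have iL : ∀ j : Fin 2, Impl (SL j) (TL j) (fun x : ℕ × ℕ => (2 * x.1 + (j : ℕ), x.2)) := by
    intro j
    refine ⟨?_, fun k => hSL j k.1 k.2, fun k => hTL j _ _ _ rfl, ?_⟩
    · rintro ⟨a, b⟩ ⟨a', b'⟩ h
      simp only [Prod.mk.injEq] at h ⊢
      omega
    · rintro ⟨a, b⟩ h
      apply hTL₀
      rintro ⟨c, hc⟩
      exact h (c, b) (by rw [hc])
  have iR : ∀ j : Fin 2, Impl (SR j) (TR j) (fun x : ℕ × ℕ => (x.1, 2 * x.2 + (j : ℕ))) := by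
    intro j
    refine ⟨?_, fun k => hSR j k.1 k.2, fun k => hTR j _ _ _ rfl, ?_⟩
    · rintro ⟨a, b⟩ ⟨a', b'⟩ h
      simp only [Prod.mk.injEq] at h ⊢
      omega
    · rintro ⟨a, b⟩ h
      apply hTR₀
      rintro ⟨c, hc⟩
      exact h (a, c) (by rw [hc])
  have hcomm : ∀ i j, SL i * SR j = SR j * SL i := by
    intro i j
    apply op_ext hp_top
    rintro ⟨a, b⟩
    change SL i (SR j _) = SR j (SL i _)
    rw [hSR, hSL, hSL, hSR]
  have hL01 : TL 0 * SL 1 = 0 := by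
    apply op_ext hp_top
    rintro ⟨a, b⟩
    change TL 0 (SL 1 _) = 0
    rw [hSL]
    apply hTL₀
    rintro ⟨c, hc⟩
    simp at hc
    omega
  have hR01 : TR 0 * SR 1 = 0 := by
    apply op_ext hp_top
    rintro ⟨a, b⟩
    change TR 0 (SR 1 _) = 0
    rw [hSR]
    apply hTR₀
    rintro ⟨c, hc⟩
    simp at hc
    omega
  have mem : ∀ x ∈ ({x | ∃ j : Fin 2, x = SL j ∨ x = TL j ∨ x = SR j ∨ x = TR j} : Set _),
      x ∈ (Algebra.adjoin ℂ
        ({x | ∃ j : Fin 2, x = SL j ∨ x = TL j ∨ x = SR j ∨ x = TR j})).topologicalClosure :=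
    fun x hx => Subalgebra.le_topologicalClosure _ (Algebra.subset_adjoin hx)
  have mSL : ∀ j, SL j ∈ _ := fun j => mem (SL j) ⟨j, Or.inl rfl⟩
  have mTL : ∀ j, TL j ∈ _ := fun j => mem (TL j) ⟨j, Or.inr (Or.inl rfl)⟩
  have mSR : ∀ j, SR j ∈ _ := fun j => mem (SR j) ⟨j, Or.inr (Or.inr (Or.inl rfl))⟩
  have mTR : ∀ j, TR j ∈ _ := fun j => mem (TR j) ⟨j, Or.inr (Or.inr (Or.inr rfl))⟩
  have hband : ∀ x ∈ ({x | ∃ j : Fin 2, x = S j ∨ x = T j} : Set _), Bd x := by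
    rintro x ⟨j, rfl | rfl⟩
    · refine ⟨1, fun k l h => ?_⟩
      rw [hS, single_ite] at h
      have hl : l = 2 * k + (j : ℕ) := by
        by_contra hne
        exact h (if_neg hne)
      rw [hl]
      exact near_double k j
    · refine ⟨1, fun k l h => ?_⟩
      by_cases hk : ∃ l : ℕ, k = 2 * l + (j : ℕ)
      · obtain ⟨m, rfl⟩ := hk
        rw [hT j _ m rfl, single_ite] at h
        have hl : l = m := by
          by_contra hne
          exact h (if_neg hne)
        rw [hl]
        exact (near_double m j).symm
      · rw [hT₀ j k hk] at h
        exact absurd rfl h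
  exact core_map hp_top hp_two φ hφ SL TL SR TR mSL mTL mSR mTR _ _ iL iR hcomm hL01 hR01
    (fun A hA => band_closure hp_top hband hA)
end
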